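/- arXiv:2408.03668 — 5 statements merged into one kernel-verified Lean document; each statement's English description precedes it below -/
import Mathlib

section
/- Suppose char(F_q) ≠ 3 and fix A ∈ ℝ. Then the set S_A has upper density strictly less than 1 in F_q[t]; that is, limsup_{T→∞} q^{−T} · #{k ∈ S_A : |k| < q^T} < 1 (the limsup being over positive integers T). -/
open Polynomial
open scoped Classical

/-- The degree of a polynomial as an extended real number, with `deg 0 = ⊥` (i.e. `-∞`). -/
noncomputable def degR {Fq : Type*} [Field Fq] (f : Polynomial Fq) : EReal :=
  if f = 0 then ⊥ else (f.natDegree : EReal)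

/-- `S_A`: the set of `k ∈ F_q[t]` representable as a sum of three cubes `x³ + y³ + z³`
with `max(deg x, deg y, deg z) ≤ (deg k)/3 + A`, the latter condition stated in the
equivalent form `3·deg w ≤ deg k + 3A` for each `w ∈ {x, y, z}`. -/
def SA {Fq : Type*} [Field Fq] (A : ℝ) (k : Polynomial Fq) : Prop :=
  ∃ x y z : Polynomial Fq, x ^ 3 + y ^ 3 + z ^ 3 = k ∧
    3 * degR x ≤ degR k + ((3 * A : ℝ) : EReal) ∧
    3 * degR y ≤ degR k + ((3 * A : ℝ) : EReal) ∧
    3 * degR z ≤ degR k + ((3 * A : ℝ) : EReal)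

lemma fiber_sum {α K : Type*} [Fintype α] [Fintype K] (g : α → K) (f : K → ℤ) :
    ∑ k, ((Finset.univ.filter (fun t => g t = k)).card : ℤ) * f k = ∑ t, f (g t) := by
  rw [← Finset.sum_fiberwise' Finset.univ g f]
  refine Finset.sum_congr rfl fun k _ => ?_
  simp

lemma exists_omega {K : Type*} [Field K] [Fintype K] (h : 3 ∣ Fintype.card K - 1) :
    ∃ w : K, w ≠ 1 ∧ w ^ 3 = 1 := by
  rw [← Fintype.card_units] at h
  have : Fact (Nat.Prime 3) := ⟨Nat.prime_three⟩
  obtain ⟨u, hu⟩ := exists_prime_orderOf_dvd_card 3 h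
  refine ⟨u, ?_, ?_⟩
  · intro h1
    have : u = 1 := Units.ext h1
    rw [this] at hu
    simp at hu
  · have h2 := pow_orderOf_eq_one u
    rw [hu] at h2
    rw [← Units.val_pow_eq_pow_val, h2, Units.val_one]

lemma field_cnt (K : Type*) [Field K] [Fintype K] (h : 3 ∣ Fintype.card K - 1) :
    ∃ a : K, Nat.card {v : (K × K) × K // v.1.1 ^ 3 + v.1.2 ^ 3 + v.2 ^ 3 = a} ≤
      Fintype.card K * (Fintype.card K - 1) := by
  obtain ⟨w, hw1, hw3⟩ := exists_omega h
  set Q := Fintype.card K with hQ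
  have hQ1 : 1 < Q := Fintype.one_lt_card
  let c : K → ℤ := fun k => ((Finset.univ.filter (fun t : K => t ^ 3 = k)).card : ℤ)
  let R : K → ℤ := fun k => ((Finset.univ.filter (fun t : K × K => t.1 ^ 3 + t.2 ^ 3 = k)).card : ℤ)
  let N : K → ℤ := fun k => ((Finset.univ.filter
    (fun v : (K × K) × K => v.1.1 ^ 3 + v.1.2 ^ 3 + v.2 ^ 3 = k)).card : ℤ)
  have hc3 : ∀ k, c k ≤ 3 := by
    intro k
    have : (Finset.univ.filter (fun t : K => t ^ 3 = k)) ⊆ (nthRoots 3 k).toFinset := by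
      intro t ht
      simp only [Finset.mem_filter, Finset.mem_univ, true_and] at ht
      rw [Multiset.mem_toFinset, mem_nthRoots (by norm_num)]
      exact ht
    have h2 := (Finset.card_le_card this).trans
      ((Multiset.toFinset_card_le _).trans (card_nthRoots 3 k))
    simp only [c]
    exact_mod_cast h2
  have hRc : ∀ m, R m = ∑ z : K, c (m - z ^ 3) := by
    intro m
    simp only [R, c, Finset.card_filter]
    push_cast
    rw [Fintype.sum_prod_type_right]
    refine Finset.sum_congr rfl fun z _ => Finset.sum_congr rfl fun x _ => ?_
    simp only [eq_sub_iff_add_eq]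
  have hRc' : ∀ m, R m = ∑ z : K, c (m + z ^ 3) := by
    intro m
    rw [hRc, ← Equiv.sum_comp (Equiv.neg K)]
    refine Finset.sum_congr rfl fun z _ => ?_
    congr 1
    simp only [Equiv.neg_apply]
    ring
  have hsc : ∑ k, c k = Q := by
    have := fiber_sum (fun t : K => t ^ 3) (fun _ => 1)
    simpa using this
  have hsR : ∑ k, R k = (Q : ℤ) ^ 2 := by
    have := fiber_sum (fun t : K × K => t.1 ^ 3 + t.2 ^ 3) (fun _ => 1)
    simp at this
    rw [sq]; exact this
  have hsN : ∑ k, N k = (Q : ℤ) ^ 3 := by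
    have := fiber_sum (fun v : (K × K) × K => v.1.1 ^ 3 + v.1.2 ^ 3 + v.2 ^ 3) (fun _ => 1)
    simp at this
    rw [pow_succ, sq]; exact this
  have hsNc : ∑ k, N k * c k = ∑ m, R m * R m := by
    have h1 := fiber_sum (fun v : (K × K) × K => v.1.1 ^ 3 + v.1.2 ^ 3 + v.2 ^ 3) c
    have h2 := fiber_sum (fun v : K × K => v.1 ^ 3 + v.2 ^ 3) R
    refine h1.trans (Eq.trans ?_ h2.symm)
    rw [Fintype.sum_prod_type]
    refine Finset.sum_congr rfl fun v _ => ?_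
    rw [hRc']
  have hcz : ∀ z : K, z ≠ 0 → 3 ≤ c (0 - z ^ 3) := by
    intro z hz
    have hw0 : w ≠ 0 := by rintro rfl; norm_num at hw3
    have hww : w * w ≠ 1 := by
      intro h
      apply hw1
      have : w ^ 3 = w * w * w := by ring
      rw [this, h, one_mul] at hw3
      exact hw3
    have hs : ({-z, -(w * z), -(w * w * z)} : Finset K) ⊆
        Finset.univ.filter (fun t : K => t ^ 3 = 0 - z ^ 3) := by
      intro t ht
      simp only [Finset.mem_insert, Finset.mem_singleton] at ht
      simp only [Finset.mem_filter, Finset.mem_univ, true_and]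
      rcases ht with rfl | rfl | rfl
      · ring
      · linear_combination (-z ^ 3) * hw3
      · linear_combination (-z ^ 3) * (w ^ 3 + 1) * hw3
    have hcard : ({-z, -(w * z), -(w * w * z)} : Finset K).card = 3 := by
      rw [Finset.card_eq_three]
      refine ⟨_, _, _, ?_, ?_, ?_, rfl⟩
      · intro h
        have : (1 - w) * z = 0 := by linear_combination -h
        rcases mul_eq_zero.1 this with h | h
        · exact hw1 (by linear_combination -h)
        · exact hz h
      · intro h
        have : (1 - w * w) * z = 0 := by linear_combination -h
        rcases mul_eq_zero.1 this with h | h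
        · exact hww (by linear_combination -h)
        · exact hz h
      · intro h
        have : w * ((1 - w) * z) = 0 := by linear_combination -h
        rcases mul_eq_zero.1 ((mul_eq_zero.1 this).resolve_left hw0) with h | h
        · exact hw1 (by linear_combination -h)
        · exact hz h
    have := Finset.card_le_card hs
    rw [hcard] at this
    simp only [c]
    exact_mod_cast this
  have hc0 : 1 ≤ c (0 - 0 ^ 3) := by
    simp only [c]
    have : 0 < (Finset.univ.filter (fun t : K => t ^ 3 = 0 - 0 ^ 3)).card :=
      Finset.card_pos.2 ⟨0, by simp⟩
    exact_mod_cast this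
  have hR0 : 3 * (Q : ℤ) - 2 ≤ R 0 := by
    have h1 : ∑ z : K, (3 - if z = 0 then (2 : ℤ) else 0) ≤ R 0 := by
      rw [hRc]
      refine Finset.sum_le_sum fun z _ => ?_
      by_cases hz : z = 0
      · subst hz; simpa using hc0
      · simpa [hz] using hcz z hz
    rw [Finset.sum_sub_distrib] at h1
    simp at h1
    rw [← hQ] at h1
    linarith
  have hS : (Q : ℤ) ^ 3 + 4 * Q ^ 2 - 4 * Q ≤ ∑ m, R m * R m := by
    have h1 : ∑ m : K, (2 * ((Q : ℤ) - 2) * R m - ((Q : ℤ) - 2) ^ 2 +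
        if m = 0 then (R 0 - (Q - 2)) ^ 2 else 0) ≤ ∑ m, R m * R m := by
      refine Finset.sum_le_sum fun m _ => ?_
      by_cases hm : m = 0
      · subst hm
        rw [if_pos rfl]
        apply le_of_eq; ring
      · rw [if_neg hm]
        nlinarith [sq_nonneg (R m - (Q - 2))]
    rw [Finset.sum_add_distrib, Finset.sum_sub_distrib, ← Finset.mul_sum, hsR] at h1
    simp at h1
    rw [← hQ] at h1
    have h2 : (2 * (Q : ℤ)) ^ 2 ≤ (R 0 - (Q - 2)) ^ 2 := by
      apply pow_le_pow_left₀ (by positivity)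
      linarith
    nlinarith
  by_contra hcon
  push Not at hcon
  have hN : ∀ a, (Q : ℤ) * (Q - 1) + 1 ≤ N a := by
    intro a
    have := hcon a
    rw [Nat.card_eq_fintype_card, Fintype.card_subtype] at this
    have h2 : (Q * (Q - 1) : ℕ) + 1 ≤ (Finset.univ.filter
      (fun v : (K × K) × K => v.1.1 ^ 3 + v.1.2 ^ 3 + v.2 ^ 3 = a)).card := this
    have h3 : ((Q * (Q - 1) : ℕ) : ℤ) + 1 ≤ N a := by
      simp only [N]
      exact_mod_cast h2
    rw [Nat.cast_mul, Nat.cast_sub hQ1.le] at h3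
    exact_mod_cast h3
  have hfin : ∑ k : K, ((Q : ℤ) * (Q - 1) + 1) * (3 - c k) ≤ ∑ k, N k * (3 - c k) := by
    refine Finset.sum_le_sum fun k _ => ?_
    exact mul_le_mul_of_nonneg_right (hN k) (by linarith [hc3 k])
  have e1 : ∑ k, N k * (3 - c k) = 3 * (Q : ℤ) ^ 3 - ∑ m, R m * R m := by
    simp only [mul_sub]
    rw [Finset.sum_sub_distrib, hsNc, ← Finset.sum_mul, hsN]
    ring
  rw [e1, ← Finset.mul_sum, Finset.sum_sub_distrib, hsc] at hfin
  simp at hfin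
  rw [← hQ] at hfin
  have hQ2 : (1 : ℤ) < Q := by exact_mod_cast hQ1
  nlinarith

lemma pi_cnt {ι : Type*} [Fintype ι] (K : ι → Type*) [∀ i, CommRing (K i)] [∀ i, Finite (K i)]
    (a : ∀ i, K i) :
    Nat.card {v : ((∀ i, K i) × (∀ i, K i)) × (∀ i, K i) //
      v.1.1 ^ 3 + v.1.2 ^ 3 + v.2 ^ 3 = a} =
    ∏ i, Nat.card {v : (K i × K i) × K i // v.1.1 ^ 3 + v.1.2 ^ 3 + v.2 ^ 3 = a i} := by
  rw [← Nat.card_pi]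
  refine Nat.card_congr ⟨fun v i => ⟨((v.1.1.1 i, v.1.1.2 i), v.1.2 i), congrFun v.2 i⟩,
    fun v => ⟨((fun i => (v i).1.1.1, fun i => (v i).1.1.2), fun i => (v i).1.2),
      funext fun i => (v i).2⟩, fun v => rfl, fun v => rfl⟩

lemma exists_primes (F : Type*) [Field F] [Fintype F] (n : ℕ) (hn : 4 ≤ n) :
    ∃ P : Finset F[X], (∀ p ∈ P, p.Monic ∧ Irreducible p ∧ p.natDegree = n) ∧
      (Fintype.card F) ^ n ≤ 2 * n * P.card := by
  obtain ⟨p, hp⟩ := CharP.exists F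
  have hpp : Fact p.Prime := ⟨CharP.char_is_prime F p⟩
  have hn0 : NeZero n := ⟨by omega⟩
  set q := Fintype.card F with hq
  have hq1 : 1 < q := Fintype.one_lt_card
  let L := FiniteField.Extension F p n
  have : Fintype L := Fintype.ofFinite L
  have hL : Fintype.card L = q ^ n := by
    rw [Fintype.card_eq_nat_card, FiniteField.natCard_extension, hq, Fintype.card_eq_nat_card]
  have hint : ∀ a : L, IsIntegral F a := fun a => Algebra.IsIntegral.isIntegral a
  let bad : Finset L := Finset.univ.filter (fun a => (minpoly F a).natDegree ≠ n)
  let good : Finset L := Finset.univ.filter (fun a => (minpoly F a).natDegree = n)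
  have hgb : good.card + bad.card = q ^ n := by
    rw [← hL]
    exact Finset.card_filter_add_card_filter_not (s := (Finset.univ : Finset L))
      (fun a => (minpoly F a).natDegree = n)
  have hbad : bad ⊆ (Finset.Icc 1 (n / 2)).biUnion
      (fun d => ((X ^ q ^ d - X : L[X]).roots).toFinset) := by
    intro a ha
    simp only [bad, Finset.mem_filter, Finset.mem_univ, true_and] at ha
    have hdvd : (minpoly F a).natDegree ∣ n := by
      have := minpoly.degree_dvd (hint a)
      rwa [FiniteField.finrank_extension] at this
    have hpos : 0 < (minpoly F a).natDegree := minpoly.natDegree_pos (hint a)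
    obtain ⟨e, he⟩ := hdvd
    have he2 : 2 ≤ e := by
      rcases e with _ | _ | e
      · omega
      · exfalso; apply ha; linarith
      · omega
    rw [Finset.mem_biUnion]
    refine ⟨(minpoly F a).natDegree, ?_, ?_⟩
    · rw [Finset.mem_Icc]
      refine ⟨hpos, ?_⟩
      rw [Nat.le_div_iff_mul_le (by norm_num)]
      calc _ ≤ (minpoly F a).natDegree * e := Nat.mul_le_mul_left _ he2
        _ = n := he.symm
    · rw [Multiset.mem_toFinset, mem_roots (FiniteField.X_pow_card_pow_sub_X_ne_zero _ hpos.ne' hq1)]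
      have h1 := ((minpoly.irreducible (hint a)).natDegree_dvd_iff_dvd_X_pow_card_pow_sub_X
        (n := (minpoly F a).natDegree)).1 dvd_rfl
      have h2 := (minpoly.dvd_iff).1 h1
      rw [← Fintype.card_eq_nat_card, ← hq] at h2
      simpa using h2
  have hbc : bad.card ≤ 2 * q ^ (n / 2) := by
    refine (Finset.card_le_card hbad).trans (Finset.card_biUnion_le.trans ?_)
    have h1 : ∀ d ∈ Finset.Icc 1 (n / 2), ((X ^ q ^ d - X : L[X]).roots).toFinset.card ≤ q ^ d := by
      intro d hd
      rw [Finset.mem_Icc] at hd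
      refine (Multiset.toFinset_card_le _).trans ((card_roots' _).trans ?_)
      rw [FiniteField.X_pow_card_pow_sub_X_natDegree_eq _ (by omega) hq1]
    refine (Finset.sum_le_sum h1).trans ?_
    generalize n / 2 = m
    induction m with
    | zero => simp
    | succ m ih =>
      rw [Finset.sum_Icc_succ_top (by omega)]
      rw [pow_succ] at *
      nlinarith [Nat.pow_pos (n := m) (show 0 < q by omega)]
  have h4 : 4 * q ^ (n / 2) ≤ q ^ n := by
    have h5 : 4 ≤ q ^ (n / 2) := by
      calc 4 = 2 ^ 2 := by norm_num
        _ ≤ q ^ 2 := Nat.pow_le_pow_left hq1 2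
        _ ≤ q ^ (n / 2) := Nat.pow_le_pow_right (by omega) (by omega)
    calc _ ≤ q ^ (n / 2) * q ^ (n / 2) := Nat.mul_le_mul_right _ h5
      _ = q ^ (n / 2 + n / 2) := by rw [pow_add]
      _ ≤ q ^ n := Nat.pow_le_pow_right (by omega) (by omega)
  refine ⟨good.image (fun a => minpoly F a), ?_, ?_⟩
  · intro f hf
    rw [Finset.mem_image] at hf
    obtain ⟨a, ha, rfl⟩ := hf
    simp only [good, Finset.mem_filter, Finset.mem_univ, true_and] at ha
    exact ⟨minpoly.monic (hint a), minpoly.irreducible (hint a), ha⟩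
  · have hg : good.card ≤ n * (good.image (fun a => minpoly F a)).card := by
      apply Finset.card_le_mul_card_image
      intro f hf
      rw [Finset.mem_image] at hf
      obtain ⟨b, hb, rfl⟩ := hf
      simp only [good, Finset.mem_filter, Finset.mem_univ, true_and] at hb
      have hs : (good.filter (fun a => minpoly F a = minpoly F b)) ⊆
          ((minpoly F b).map (algebraMap F L)).roots.toFinset := by
        intro a ha
        rw [Finset.mem_filter] at ha
        rw [Multiset.mem_toFinset, mem_roots (((minpoly.monic (hint b)).map _).ne_zero), ← ha.2]
        simp
      refine (Finset.card_le_card hs).trans ((Multiset.toFinset_card_le _).trans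
        ((card_roots' _).trans ?_))
      rw [natDegree_map, hb]
    rw [mul_assoc]
    omega

lemma three_dvd (F : Type*) [Field F] [Fintype F] (hchar : ringChar F ≠ 3) (l : ℕ) :
    3 ∣ Fintype.card F ^ (2 * l) - 1 := by
  obtain ⟨n, hp, hn⟩ := FiniteField.card F (ringChar F)
  have h3 : ¬ 3 ∣ Fintype.card F := by
    rw [hn]
    intro h
    have := Nat.prime_three.dvd_of_dvd_pow h
    exact hchar ((Nat.prime_dvd_prime_iff_eq Nat.prime_three hp).1 this).symm
  have h1 : Fintype.card F ^ 2 % 3 = 1 := by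
    have : Fintype.card F % 3 = 1 ∨ Fintype.card F % 3 = 2 := by omega
    rcases this with h | h <;> simp [Nat.pow_mod, h]
  have h2 : Fintype.card F ^ (2 * l) % 3 = 1 := by
    rw [pow_mul, Nat.pow_mod, h1]
    simp
  omega

lemma prime_sets (F : Type*) [Field F] [Fintype F] (hchar : ringChar F ≠ 3) (ε : ℝ) (hε : 0 < ε) :
    ∃ s : Finset F[X], (∀ p ∈ s, p.Monic ∧ Irreducible p ∧
        3 ∣ Fintype.card F ^ p.natDegree - 1) ∧
      ∏ p ∈ s, (1 - 1 / (Fintype.card F : ℝ) ^ p.natDegree) ≤ ε := by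
  have hq1 : 1 < Fintype.card F := Fintype.one_lt_card
  set q := Fintype.card F with hq
  have hq0 : (0 : ℝ) < q := by exact_mod_cast (by omega : 0 < q)
  choose P hP hPc using fun l : ℕ => exists_primes F (2 * (l + 2)) (by omega)
  have ht := Real.tendsto_sum_range_one_div_nat_succ_atTop
  obtain ⟨M, hM⟩ := (ht.eventually_ge_atTop (8 * (-Real.log ε))).exists
  refine ⟨(Finset.range M).biUnion P, ?_, ?_⟩
  · intro p hp
    rw [Finset.mem_biUnion] at hp
    obtain ⟨l, -, hl⟩ := hp
    obtain ⟨h1, h2, h3⟩ := hP l p hl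
    refine ⟨h1, h2, ?_⟩
    rw [h3]
    exact three_dvd F hchar _
  · have hdisj : (↑(Finset.range M) : Set ℕ).PairwiseDisjoint P := by
      intro i _ j _ hij
      rw [Function.onFun, Finset.disjoint_left]
      intro p hi hj
      have h1 := (hP i p hi).2.2
      have h2 := (hP j p hj).2.2
      omega
    have hle : ∏ p ∈ (Finset.range M).biUnion P, (1 - 1 / (q : ℝ) ^ p.natDegree) ≤
        Real.exp (-∑ p ∈ (Finset.range M).biUnion P, 1 / (q : ℝ) ^ p.natDegree) := by
      rw [← Finset.sum_neg_distrib, Real.exp_sum]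
      refine Finset.prod_le_prod (fun p _ => ?_) fun p _ => ?_
      · rw [sub_nonneg, div_le_one (by positivity)]
        exact one_le_pow₀ (by exact_mod_cast hq1.le)
      · have := Real.add_one_le_exp (-(1 / (q : ℝ) ^ p.natDegree))
        linarith
    refine hle.trans ?_
    rw [← Real.le_log_iff_exp_le hε]
    have hs : ∑ i ∈ Finset.range M, (1 / 8 : ℝ) * (1 / ((i : ℝ) + 1)) ≤
        ∑ p ∈ (Finset.range M).biUnion P, 1 / (q : ℝ) ^ p.natDegree := by
      rw [Finset.sum_biUnion hdisj]
      refine Finset.sum_le_sum fun l _ => ?_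
      have : ∑ p ∈ P l, 1 / (q : ℝ) ^ p.natDegree = (P l).card * (1 / (q : ℝ) ^ (2 * (l + 2))) := by
        rw [← nsmul_eq_mul, ← Finset.sum_const]
        exact Finset.sum_congr rfl fun p hp => by rw [(hP l p hp).2.2]
      rw [this]
      have h1 : (q : ℝ) ^ (2 * (l + 2)) ≤ 2 * (2 * (l + 2)) * (P l).card := by
        exact_mod_cast hPc l
      have hl : (0 : ℝ) ≤ l := by positivity
      have hc : (0 : ℝ) ≤ (P l).card := by positivity
      rw [mul_one_div, mul_one_div, div_le_div_iff₀ (by positivity) (by positivity)]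
      nlinarith [mul_nonneg hl hc]
    rw [← Finset.mul_sum] at hs
    linarith

lemma fiber_card (F R : Type*) [Field F] [Fintype F] [CommRing R] [Finite R] (φ : F[X] →+* R)
    (hφ : Function.Surjective φ) :
    ∃ m₀ : ℕ, ∀ m ≥ m₀, ∀ r : R,
      Nat.card {f : F[X] // f.degree < (m : WithBot ℕ) ∧ φ f = r} * Nat.card R =
        Fintype.card F ^ m := by
  have : Fintype R := Fintype.ofFinite R
  choose g hg using hφ
  refine ⟨Finset.univ.sup (fun r => (g r).natDegree + 1), fun m hm r => ?_⟩
  let e := (degreeLTEquiv F m).toEquiv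
  have : Fintype (degreeLT F m) := Fintype.ofEquiv _ e.symm
  let ψ : degreeLT F m →+ R := φ.toAddMonoidHom.comp (degreeLT F m).subtype.toAddMonoidHom
  have hψ : ∀ x : degreeLT F m, ψ x = φ x.1 := fun x => rfl
  have hsurj : ∀ r, r ∈ Set.range ψ := by
    intro r
    have h1 : (g r).natDegree + 1 ≤ m :=
      (Finset.le_sup (f := fun r => (g r).natDegree + 1) (Finset.mem_univ r)).trans hm
    refine ⟨⟨g r, ?_⟩, hg r⟩
    rw [mem_degreeLT]
    exact degree_le_natDegree.trans_lt (by exact_mod_cast h1)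
  have hfib : ∀ r', (Finset.univ.filter (fun x => ψ x = r')).card =
      (Finset.univ.filter (fun x => ψ x = r)).card := fun r' =>
    AddMonoidHom.card_fiber_eq_of_mem_range ψ (hsurj r') (hsurj r)
  have hcard : Nat.card {f : F[X] // f.degree < (m : WithBot ℕ) ∧ φ f = r} =
      (Finset.univ.filter (fun x => ψ x = r)).card := by
    rw [← Fintype.card_subtype, ← Nat.card_eq_fintype_card]
    exact Nat.card_congr ⟨fun f => ⟨⟨f.1, mem_degreeLT.2 f.2.1⟩, f.2.2⟩,
      fun x => ⟨x.1.1, mem_degreeLT.1 x.1.2, x.2⟩, fun _ => rfl, fun _ => rfl⟩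
  have htot : Fintype.card (degreeLT F m) = Fintype.card F ^ m := by
    rw [Fintype.card_congr e]; simp
  have hall : Fintype.card (degreeLT F m) =
      ∑ r' : R, (Finset.univ.filter (fun x => ψ x = r')).card := by
    rw [← Finset.card_univ]
    exact Finset.card_eq_sum_card_fiberwise (fun _ _ => by simp)
  rw [hcard, ← htot, hall, Finset.sum_congr rfl (fun r' _ => hfib r'), Finset.sum_const,
    smul_eq_mul, mul_comm, Nat.card_eq_fintype_card, Finset.card_univ]

universe u

lemma exists_modulus (F : Type u) [Field F] [Fintype F] (hchar : ringChar F ≠ 3)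
    (ε : ℝ) (hε : 0 < ε) :
    ∃ (R : Type u) (_ : CommRing R) (_ : Finite R) (φ : F[X] →+* R) (a : R),
      Function.Surjective φ ∧
      (Nat.card {v : (R × R) × R // v.1.1 ^ 3 + v.1.2 ^ 3 + v.2 ^ 3 = a} : ℝ) ≤
        ε * (Nat.card R : ℝ) ^ 2 := by
  obtain ⟨s, hs, hprod⟩ := prime_sets F hchar ε hε
  let I : s → Ideal F[X] := fun p => Ideal.span {p.1}
  have hmax : ∀ p, (I p).IsMaximal := fun p =>
    PrincipalIdealRing.isMaximal_of_irreducible (hs p.1 p.2).2.1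
  let K : s → Type u := fun p => F[X] ⧸ I p
  have hfr : ∀ p, Module.finrank F (K p) = p.1.natDegree := fun p =>
    finrank_quotient_span_eq_natDegree
  have hfin : ∀ p, Module.Finite F (K p) := fun p =>
    (hs p.1 p.2).1.finite_quotient
  have hfin' : ∀ p, Finite (K p) := fun p => Module.finite_of_finite F
  have hcard : ∀ p, Nat.card (K p) = Fintype.card F ^ p.1.natDegree := fun p => by
    rw [Module.natCard_eq_pow_finrank (K := F), hfr, Nat.card_eq_fintype_card]
  have hloc : ∀ p : s, ∃ a : K p,
      Nat.card {v : (K p × K p) × K p // v.1.1 ^ 3 + v.1.2 ^ 3 + v.2 ^ 3 = a} ≤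
        Nat.card (K p) * (Nat.card (K p) - 1) := by
    intro p
    let _ : Field (K p) := Ideal.Quotient.field (I p)
    let _ : Fintype (K p) := Fintype.ofFinite _
    have h3 : 3 ∣ Fintype.card (K p) - 1 := by
      rw [Fintype.card_eq_nat_card, hcard]
      exact (hs p.1 p.2).2.2
    have := field_cnt (K p) h3
    rw [Fintype.card_eq_nat_card] at this
    exact this
  choose a ha using hloc
  have hcop : Pairwise (Function.onFun IsCoprime I) := by
    intro p p' hne
    have hp := hs p.1 p.2
    have hp' := hs p'.1 p'.2
    apply Ideal.isCoprime_iff_sup_eq.2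
    apply Ideal.IsMaximal.coprime_of_ne (hmax p) (hmax p')
    intro h
    rw [Ideal.span_singleton_eq_span_singleton] at h
    exact hne (Subtype.ext (eq_of_monic_of_associated hp.1 hp'.1 h))
  refine ⟨∀ p, K p, inferInstance, inferInstance,
    RingHom.pi (fun p => Ideal.Quotient.mk (I p)), a, ?_, ?_⟩
  · intro x
    obtain ⟨r, hr⟩ := Ideal.pi_quotient_surjective hcop x
    exact ⟨r, funext hr⟩
  · rw [pi_cnt, Nat.card_pi]
    push_cast
    rw [← Finset.prod_pow]
    have h1 : ∏ p : s, (1 - 1 / (Fintype.card F : ℝ) ^ p.1.natDegree) ≤ ε := by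
      rw [Finset.prod_coe_sort s (fun p => (1 - 1 / (Fintype.card F : ℝ) ^ p.natDegree))]
      exact hprod
    refine le_trans ?_ (mul_le_mul_of_nonneg_right h1
      (Finset.prod_nonneg fun p _ => by positivity))
    rw [← Finset.prod_mul_distrib]
    refine Finset.prod_le_prod (fun p _ => by positivity) fun p _ => ?_
    have hpos : 0 < Nat.card (K p) := by
      rw [hcard]
      exact Nat.pow_pos Fintype.card_pos
    have h2 : (Nat.card {v : (K p × K p) × K p // v.1.1 ^ 3 + v.1.2 ^ 3 + v.2 ^ 3 = a p} : ℝ) ≤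
        ((Nat.card (K p) * (Nat.card (K p) - 1) : ℕ) : ℝ) := by
      exact_mod_cast ha p
    refine h2.trans (le_of_eq ?_)
    have h4 : (Fintype.card F : ℝ) ^ p.1.natDegree = Nat.card (K p) := by
      rw [hcard]; push_cast; rfl
    rw [h4, Nat.cast_mul, Nat.cast_sub hpos]
    have h5 : (Nat.card (K p) : ℝ) ≠ 0 := by exact_mod_cast hpos.ne'
    field_simp
    push_cast
    ring

lemma degree_bound {F : Type*} [Field F] (A : ℝ) (T : ℕ) (k x : F[X])
    (hk : k.degree < (T : WithBot ℕ))
    (h : 3 * degR x ≤ degR k + ((3 * A : ℝ) : EReal)) :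
    x.degree < ((T / 3 + (⌈|A|⌉₊ + 1) : ℕ) : WithBot ℕ) := by
  by_cases hx : x = 0
  · subst hx
    rw [degree_zero]
    exact WithBot.bot_lt_coe _
  have hkT : degR k ≤ ((T : ℝ) : EReal) := by
    unfold degR
    split_ifs with h0
    · exact bot_le
    · have := (natDegree_lt_iff_degree_lt h0).2 hk
      have h2 : (k.natDegree : ℝ) ≤ T := by exact_mod_cast this.le
      exact_mod_cast h2
  have h1 : 3 * degR x ≤ (((T : ℝ) + 3 * A : ℝ) : EReal) := by
    refine h.trans ?_
    rw [EReal.coe_add]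
    exact add_le_add_left hkT _
  have h2 : (3 : ℝ) * x.natDegree ≤ T + 3 * A := by
    rw [degR, if_neg hx] at h1
    have h3 : (3 * (x.natDegree : EReal)) = (((3 : ℝ) * (x.natDegree : ℝ) : ℝ) : EReal) := by
      rw [EReal.coe_mul]; rfl
    rw [h3] at h1
    exact EReal.coe_le_coe_iff.1 h1
  rw [← natDegree_lt_iff_degree_lt hx]
  have h4 : (T : ℝ) < 3 * ((T / 3 : ℕ) : ℝ) + 3 := by
    have : T < 3 * (T / 3) + 3 := by omega
    exact_mod_cast this
  have h5 : A ≤ ⌈|A|⌉₊ := (le_abs_self A).trans (Nat.le_ceil _)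
  have h6 : (x.natDegree : ℝ) < ((T / 3 : ℕ) : ℝ) + ((⌈|A|⌉₊ : ℝ) + 1) := by linarith
  exact_mod_cast h6

lemma trip_card (F R : Type*) [Field F] [Fintype F] [CommRing R] [Finite R] (φ : F[X] →+* R)
    (m c : ℕ) (hc : ∀ r : R, Nat.card {f : F[X] // f.degree < (m : WithBot ℕ) ∧ φ f = r} = c)
    (hc0 : 0 < c) (a : R) :
    {v : (F[X] × F[X]) × F[X] | (v.1.1.degree < (m : WithBot ℕ) ∧ v.1.2.degree < (m : WithBot ℕ) ∧
      v.2.degree < (m : WithBot ℕ)) ∧ φ (v.1.1 ^ 3 + v.1.2 ^ 3 + v.2 ^ 3) = a}.Finite ∧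
    {v : (F[X] × F[X]) × F[X] | (v.1.1.degree < (m : WithBot ℕ) ∧ v.1.2.degree < (m : WithBot ℕ) ∧
      v.2.degree < (m : WithBot ℕ)) ∧ φ (v.1.1 ^ 3 + v.1.2 ^ 3 + v.2 ^ 3) = a}.ncard =
      Nat.card {v : (R × R) × R // v.1.1 ^ 3 + v.1.2 ^ 3 + v.2 ^ 3 = a} * c ^ 3 := by
  let fib : R → Type _ := fun r => {f : F[X] // f.degree < (m : WithBot ℕ) ∧ φ f = r}
  have hf : ∀ r, Finite (fib r) := fun r => Nat.finite_of_card_ne_zero (by rw [hc r]; omega)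
  let W := {v : (R × R) × R // v.1.1 ^ 3 + v.1.2 ^ 3 + v.2 ^ 3 = a}
  set S := {v : (F[X] × F[X]) × F[X] | (v.1.1.degree < (m : WithBot ℕ) ∧
      v.1.2.degree < (m : WithBot ℕ) ∧
      v.2.degree < (m : WithBot ℕ)) ∧ φ (v.1.1 ^ 3 + v.1.2 ^ 3 + v.2 ^ 3) = a} with hS
  let e : S ≃ Σ w : W, (fib w.1.1.1 × fib w.1.1.2) × fib w.1.2 :=
    { toFun := fun v => ⟨⟨((φ v.1.1.1, φ v.1.1.2), φ v.1.2), by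
          have := v.2.2; simpa using this⟩,
        ((⟨v.1.1.1, v.2.1.1, rfl⟩, ⟨v.1.1.2, v.2.1.2.1, rfl⟩), ⟨v.1.2, v.2.1.2.2, rfl⟩)⟩
      invFun := fun w => ⟨((w.2.1.1.1, w.2.1.2.1), w.2.2.1),
        ⟨w.2.1.1.2.1, w.2.1.2.2.1, w.2.2.2.1⟩, by
          simp only [map_add, map_pow, w.2.1.1.2.2, w.2.1.2.2.2, w.2.2.2.2]
          exact w.1.2⟩
      left_inv := fun v => rfl
      right_inv := by
        rintro ⟨⟨⟨⟨r1, r2⟩, r3⟩, hw⟩, ⟨⟨⟨f1, h1, e1⟩, ⟨f2, h2, e2⟩⟩, ⟨f3, h3, e3⟩⟩⟩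
        dsimp only at e1 e2 e3
        subst e1 e2 e3
        rfl }
  have hSf : Finite S := Finite.of_equiv _ e.symm
  refine ⟨Set.toFinite S, ?_⟩
  rw [← Nat.card_coe_set_eq, Nat.card_congr e]
  have : Fintype W := Fintype.ofFinite W
  rw [Nat.card_sigma]
  have h1 : ∀ w : W, Nat.card ((fib w.1.1.1 × fib w.1.1.2) × fib w.1.2) = c ^ 3 := by
    intro w
    rw [Nat.card_prod, Nat.card_prod]
    have h2 : ∀ r, Nat.card (fib r) = c := hc
    rw [h2, h2, h2]; ring
  rw [Finset.sum_congr rfl (fun w _ => h1 w), Finset.sum_const, smul_eq_mul, Finset.card_univ,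
    Nat.card_eq_fintype_card]

lemma degree_lt_card (F : Type*) [Field F] [Fintype F] (T : ℕ) :
    {k : F[X] | k.degree < (T : WithBot ℕ)}.Finite ∧
    {k : F[X] | k.degree < (T : WithBot ℕ)}.ncard = Fintype.card F ^ T := by
  let e : {k : F[X] | k.degree < (T : WithBot ℕ)} ≃ (Fin T → F) :=
    (Equiv.subtypeEquivRight (fun k => mem_degreeLT.symm)).trans (degreeLTEquiv F T).toEquiv
  have : Finite {k : F[X] | k.degree < (T : WithBot ℕ)} := Finite.of_equiv _ e.symm
  refine ⟨Set.toFinite _, ?_⟩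
  rw [← Nat.card_coe_set_eq, Nat.card_congr e]
  simp

lemma density_bound (F : Type u) [Field F] [Fintype F] (hchar : ringChar F ≠ 3) (A : ℝ) :
    ∃ δ : ℝ, 0 < δ ∧ ∃ T₀ : ℕ, ∀ T ≥ T₀,
      (Nat.card {k : F[X] // SA A k ∧ k.degree < (T : WithBot ℕ)} : ℝ) /
        (Fintype.card F : ℝ) ^ T ≤ 1 - δ := by
  set q := Fintype.card F with hq
  have hq0 : 0 < q := Fintype.card_pos
  have hq0' : (0 : ℝ) < q := by exact_mod_cast hq0
  have hq1' : (1 : ℝ) ≤ q := by exact_mod_cast hq0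
  set b := ⌈|A|⌉₊ + 1 with hb
  obtain ⟨R, iR, iF, φ, a, hφ, hcnt⟩ := exists_modulus F hchar (1 / (2 * (q : ℝ) ^ (3 * b)))
    (by positivity)
  obtain ⟨m₀, hm₀⟩ := fiber_card F R φ hφ
  set M := Nat.card R with hM
  have hM0 : 0 < M := Nat.card_pos
  have hM0' : (0 : ℝ) < M := by exact_mod_cast hM0
  refine ⟨1 / (2 * M), by positivity, 3 * m₀, fun T hT => ?_⟩
  set m := T / 3 + b with hm
  have hmm : m₀ ≤ m := by omega
  have hTm : m₀ ≤ T := by omega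
  have h3m : 3 * m ≤ T + 3 * b := by omega
  obtain ⟨c, hc⟩ : ∃ c, ∀ r : R,
      Nat.card {f : F[X] // f.degree < (m : WithBot ℕ) ∧ φ f = r} = c := by
    refine ⟨Fintype.card F ^ m / M, fun r => ?_⟩
    rw [← hm₀ m hmm r, Nat.mul_div_cancel _ hM0]
  have hcM : c * M = q ^ m := by rw [← hc a]; exact hm₀ m hmm a
  have hc0 : 0 < c := by
    rcases Nat.eq_zero_or_pos c with h | h
    · rw [h, zero_mul] at hcM
      exact absurd hcM (Nat.pow_pos hq0).ne
    · exact h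
  obtain ⟨hSf, hSc⟩ := trip_card F R φ m c hc hc0 a
  set S := {v : (F[X] × F[X]) × F[X] | (v.1.1.degree < (m : WithBot ℕ) ∧
      v.1.2.degree < (m : WithBot ℕ) ∧
      v.2.degree < (m : WithBot ℕ)) ∧ φ (v.1.1 ^ 3 + v.1.2 ^ 3 + v.2 ^ 3) = a} with hS
  obtain ⟨hGf, hGc⟩ := degree_lt_card F T
  set G := {k : F[X] | k.degree < (T : WithBot ℕ)} with hG
  let C : Set F[X] := {k : F[X] | k.degree < (T : WithBot ℕ) ∧ φ k = a}
  have hCG : C ⊆ G := fun k hk => hk.1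
  have hCc : C.ncard * M = q ^ T := by
    rw [← Nat.card_coe_set_eq]
    exact hm₀ T hTm a
  have hsub : {k : F[X] | SA A k ∧ k.degree < (T : WithBot ℕ)} ⊆
      (G \ C) ∪ Set.image (fun v : (F[X] × F[X]) × F[X] => v.1.1 ^ 3 + v.1.2 ^ 3 + v.2 ^ 3) S := by
    rintro k ⟨⟨x, y, z, hk, hx, hy, hz⟩, hkT⟩
    by_cases hka : φ k = a
    · right
      refine ⟨((x, y), z), ⟨⟨degree_bound A T k x hkT hx, degree_bound A T k y hkT hy,
        degree_bound A T k z hkT hz⟩, ?_⟩, hk⟩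
      rw [← hka, ← hk]
    · left
      exact ⟨hkT, fun h => hka h.2⟩
  have hle : Nat.card {k : F[X] // SA A k ∧ k.degree < (T : WithBot ℕ)} ≤
      (G \ C).ncard + S.ncard := by
    have h1 := Set.ncard_le_ncard hsub ((hGf.subset Set.sdiff_subset).union (hSf.image _))
    have h2 := Set.ncard_union_le (G \ C)
      (Set.image (fun v : (F[X] × F[X]) × F[X] => v.1.1 ^ 3 + v.1.2 ^ 3 + v.2 ^ 3) S)
    have h3 := Set.ncard_image_le (f := fun v : (F[X] × F[X]) × F[X] =>
      v.1.1 ^ 3 + v.1.2 ^ 3 + v.2 ^ 3) hSf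
    rw [← Nat.card_coe_set_eq] at h1
    exact h1.trans (h2.trans (Nat.add_le_add_left h3 _))
  have hd : (G \ C).ncard + C.ncard = q ^ T := by
    rw [Set.ncard_sdiff_add_ncard_of_subset hCG hGf, hGc]
  have hS2 : (S.ncard : ℝ) ≤ (q : ℝ) ^ T / (2 * M) := by
    rw [hSc]
    push_cast
    have hcr : (c : ℝ) * M = (q : ℝ) ^ m := by exact_mod_cast hcM
    have hc3 : (0 : ℝ) ≤ (c : ℝ) ^ 3 := by positivity
    refine (mul_le_mul_of_nonneg_right hcnt hc3).trans ?_
    have hp : ((c : ℝ) * M) ^ 3 ≤ (q : ℝ) ^ T * (q : ℝ) ^ (3 * b) := by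
      rw [hcr, ← pow_mul, ← pow_add]
      exact pow_le_pow_right₀ hq1' (by omega)
    have hqb : (0 : ℝ) < (q : ℝ) ^ (3 * b) := by positivity
    rw [le_div_iff₀ (by positivity)]
    have e1 : 1 / (2 * (q : ℝ) ^ (3 * b)) * (M : ℝ) ^ 2 * (c : ℝ) ^ 3 * (2 * M) =
        ((c : ℝ) * M) ^ 3 / (q : ℝ) ^ (3 * b) := by
      field_simp
    rw [e1, div_le_iff₀ hqb]
    exact hp
  have hCr : (C.ncard : ℝ) = (q : ℝ) ^ T / M := by
    rw [eq_div_iff hM0'.ne']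
    exact_mod_cast hCc
  have hdr : ((G \ C).ncard : ℝ) + C.ncard = (q : ℝ) ^ T := by exact_mod_cast hd
  have hler : (Nat.card {k : F[X] // SA A k ∧ k.degree < (T : WithBot ℕ)} : ℝ) ≤
      (G \ C).ncard + S.ncard := by exact_mod_cast hle
  have hqT : (0 : ℝ) < (q : ℝ) ^ T := by positivity
  rw [div_le_iff₀ hqT]
  have e2 : (1 - 1 / (2 * (M : ℝ))) * (q : ℝ) ^ T =
      (q : ℝ) ^ T - (q : ℝ) ^ T / M + (q : ℝ) ^ T / (2 * M) := by
    field_simp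
    ring
  rw [e2]
  linarith

/-- Suppose `char(F_q) ≠ 3` and fix `A ∈ ℝ`. Then `S_A` has upper density strictly
less than `1`: `limsup_{T → ∞} q^{-T} · #{k ∈ S_A : |k| < q^T} < 1`. -/
theorem upper_density_SA_lt_one (Fq : Type*) [Field Fq] [Fintype Fq]
    (hchar : ringChar Fq ≠ 3) (A : ℝ) :
    Filter.limsup (fun T : ℕ =>
      (Nat.card {k : Polynomial Fq // SA A k ∧ k.degree < (T : WithBot ℕ)} : ℝ) /
        (Fintype.card Fq : ℝ) ^ T) Filter.atTop < 1 := by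
  obtain ⟨δ, hδ, T₀, hT⟩ := density_bound Fq hchar A
  refine lt_of_le_of_lt (b := 1 - δ) ?_ (by linarith)
  refine Filter.limsup_le_of_le ?_ (Filter.eventually_atTop.2 ⟨T₀, hT⟩)
  exact Filter.isCoboundedUnder_le_of_le Filter.atTop (x := 0) (fun T => by positivity)
end

section
/- Suppose char(F_q) ≠ 3. For every ε > 0 there exists a monic polynomial r ∈ F_q[t] such that ρ(r) < ε·|r|². -/
open Polynomial

noncomputable section

theorem monFinite (k : Type*) [Field k] [Finite k] (n : ℕ) :
    {f : k[X] | f.Monic ∧ f.natDegree = n}.Finite := by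
  apply Set.Finite.of_finite_image (f := fun f : k[X] => fun i : Fin n => f.coeff i)
  · exact Set.toFinite _
  · rintro f ⟨hf, hfn⟩ g ⟨hg, hgn⟩ h
    ext i
    rcases lt_trichotomy i n with hi | hi | hi
    · exact congrFun h ⟨i, hi⟩
    · subst hi
      have h1 : f.coeff i = 1 := by rw [← hfn]; exact hf
      have h2 : g.coeff i = 1 := by rw [← hgn]; exact hg
      rw [h1, h2]
    · rw [coeff_eq_zero_of_natDegree_lt (by omega), coeff_eq_zero_of_natDegree_lt (by omega)]

/-- monic polynomials of degree n -/
def Mon (k : Type*) [Field k] [Finite k] (n : ℕ) : Finset k[X] := (monFinite k n).toFinset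

theorem mem_Mon {k : Type*} [Field k] [Finite k] {n : ℕ} {f : k[X]} :
    f ∈ Mon k n ↔ f.Monic ∧ f.natDegree = n := by simp [Mon]

open Classical in
/-- monic irreducible polynomials of degree at most n -/
def Irr (k : Type*) [Field k] [Finite k] (n : ℕ) : Finset k[X] :=
  ((Finset.range (n+1)).biUnion (Mon k)).filter Irreducible

theorem mem_Irr {k : Type*} [Field k] [Finite k] {n : ℕ} {f : k[X]} :
    f ∈ Irr k n ↔ f.Monic ∧ f.natDegree ≤ n ∧ Irreducible f := by
  simp [Irr, mem_Mon]; constructor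
  · rintro ⟨⟨h1, h2⟩, h3⟩; exact ⟨h2, by omega, h3⟩
  · rintro ⟨h1, h2, h3⟩; exact ⟨⟨by omega, h1⟩, h3⟩

/-- prime power sum -/
def GG {k : Type*} [Field k] [Finite k] (l : k[X] → ℂ) (j : ℕ) : ℂ :=
  ∑ P ∈ Irr k j, if P.natDegree ∣ j then (P.natDegree : ℂ) * l P ^ (j / P.natDegree) else 0

theorem GG_eq {k : Type*} [Field k] [Finite k] (l : k[X] → ℂ) (j N : ℕ) (hj : 0 < j) (h : j ≤ N) :
    GG l j = ∑ P ∈ Irr k N,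
      if P.natDegree ∣ j then (P.natDegree : ℂ) * l P ^ (j / P.natDegree) else 0 := by
  unfold GG
  apply Finset.sum_subset
  · intro P; rw [mem_Irr, mem_Irr]; rintro ⟨a, b, c⟩; exact ⟨a, by omega, c⟩
  · intro P hP hP'
    rw [mem_Irr] at hP hP'
    rw [if_neg]
    intro hd
    exact hP' ⟨hP.1, Nat.le_of_dvd hj hd, hP.2.2⟩

def AA {k : Type*} [Field k] [Finite k] (l : k[X] → ℂ) (n : ℕ) : ℂ := ∑ f ∈ Mon k n, l f

/-- sum over multiples -/
theorem sum_mult {k : Type*} [Field k] [Finite k] (l : k[X] → ℂ)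
    (hl : ∀ f g, l (f * g) = l f * l g) (n m : ℕ) (hm : m ≤ n) (R : k[X]) (hR : R.Monic)
    (hRd : R.natDegree = m) :
    (∑ f ∈ Mon k n, by classical exact if R ∣ f then l f else 0) = l R * AA l (n - m) := by
  classical
  rw [← Finset.sum_filter, AA, Finset.mul_sum]
  symm
  apply Finset.sum_bij (fun g _ => R * g)
  · intro g hg
    rw [mem_Mon] at hg
    rw [Finset.mem_filter, mem_Mon]
    refine ⟨⟨hR.mul hg.1, ?_⟩, dvd_mul_right _ _⟩
    rw [hR.natDegree_mul hg.1]; omega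
  · intro a _ b _ h
    exact mul_left_cancel₀ hR.ne_zero h
  · intro f hf
    rw [Finset.mem_filter, mem_Mon] at hf
    obtain ⟨⟨h1, h2⟩, g, rfl⟩ := hf
    have hg : g.Monic := hR.of_mul_monic_left h1
    refine ⟨g, ?_, rfl⟩
    rw [mem_Mon]
    rw [hR.natDegree_mul hg] at h2
    exact ⟨hg, by omega⟩
  · intro g _
    rw [hl]

theorem sum_divs (n d c : ℕ) (hd : 0 < d) (hc : d * c ≤ n) :
    (∑ j ∈ Finset.Icc 1 n, if d ∣ j ∧ j / d ≤ c then d else 0) = d * c := by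
  rw [← Finset.sum_filter, Finset.sum_const, smul_eq_mul, mul_comm]
  congr 1
  have : (Finset.Icc 1 n).filter (fun j => d ∣ j ∧ j / d ≤ c) = (Finset.Icc 1 c).image (d * ·) := by
    ext j
    simp only [Finset.mem_filter, Finset.mem_Icc, Finset.mem_image]
    constructor
    · rintro ⟨⟨h1, h2⟩, ⟨e, rfl⟩, h3⟩
      rw [Nat.mul_div_cancel_left _ hd] at h3
      exact ⟨e, ⟨Nat.pos_of_ne_zero (by rintro rfl; simp at h1), h3⟩, rfl⟩
    · rintro ⟨e, ⟨h1, h2⟩, rfl⟩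
      rw [Nat.mul_div_cancel_left _ hd]
      refine ⟨⟨Nat.mul_pos hd h1, (Nat.mul_le_mul_left d h2).trans hc⟩, dvd_mul_right _ _, h2⟩
  rw [this, Finset.card_image_of_injective, Nat.card_Icc]
  · simp
  · intro a b h; exact Nat.eq_of_mul_eq_mul_left hd h

theorem deg_eq {k : Type*} [Field k] [Finite k] (n : ℕ) (f : k[X]) (hf : f ∈ Mon k n) :
    (∑ j ∈ Finset.Icc 1 n, ∑ P ∈ Irr k n, by
      classical exact if P.natDegree ∣ j ∧ P ^ (j / P.natDegree) ∣ f then P.natDegree else 0) = n := by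
  classical
  rw [mem_Mon] at hf
  rw [Finset.sum_comm]
  have hf0 := hf.1.ne_zero
  have key : ∀ P ∈ Irr k n, (∑ j ∈ Finset.Icc 1 n,
      if P.natDegree ∣ j ∧ P ^ (j / P.natDegree) ∣ f then P.natDegree else 0)
      = P.natDegree * (UniqueFactorizationMonoid.normalizedFactors f).count P := by
    intro P hP
    rw [mem_Irr] at hP
    have hc : ∀ m : ℕ, P ^ m ∣ f ↔ m ≤ (UniqueFactorizationMonoid.normalizedFactors f).count P := by
      intro m
      rw [pow_dvd_iff_le_emultiplicity,
        UniqueFactorizationMonoid.emultiplicity_eq_count_normalizedFactors hP.2.2 hf0,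
        hP.1.normalize_eq_self, Nat.cast_le]
    simp only [hc]
    apply sum_divs
    · exact hP.2.2.natDegree_pos
    · have := natDegree_le_of_dvd ((hc _).2 le_rfl) hf0
      rw [natDegree_pow, hf.2] at this
      rw [mul_comm]; exact this
  rw [Finset.sum_congr rfl key]
  have h1 : f = (UniqueFactorizationMonoid.normalizedFactors f).prod := by
    have := UniqueFactorizationMonoid.prod_normalizedFactors_eq hf0
    rw [this, hf.1.normalize_eq_self]
  have h2 : n = ((UniqueFactorizationMonoid.normalizedFactors f).map natDegree).sum := by
    rw [← natDegree_multiset_prod, ← h1, hf.2]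
    intro h
    exact UniqueFactorizationMonoid.zero_notMem_normalizedFactors _ h
  conv_rhs => rw [h2, Finset.sum_multiset_map_count]
  symm
  simp only [smul_eq_mul]
  rw [Finset.sum_congr rfl (fun P _ => mul_comm _ _)]
  apply Finset.sum_subset
  · intro P hP
    rw [Multiset.mem_toFinset] at hP
    rw [mem_Irr]
    refine ⟨?_, ?_, UniqueFactorizationMonoid.irreducible_of_normalized_factor _ hP⟩
    · have := UniqueFactorizationMonoid.normalize_normalized_factor _ hP
      rw [← this]
      exact monic_normalize (UniqueFactorizationMonoid.irreducible_of_normalized_factor _ hP).ne_zero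
    · rw [← hf.2]
      exact natDegree_le_of_dvd (UniqueFactorizationMonoid.dvd_of_mem_normalizedFactors hP) hf0
  · intro P _ hP
    rw [Multiset.mem_toFinset] at hP
    rw [Multiset.count_eq_zero_of_notMem hP, mul_zero]

theorem newton {k : Type*} [Field k] [Finite k] (l : k[X] → ℂ)
    (hl : ∀ f g, l (f * g) = l f * l g) (hl1 : l 1 = 1) (n : ℕ) :
    (n : ℂ) * AA l n = ∑ j ∈ Finset.Icc 1 n, GG l j * AA l (n - j) := by
  classical
  have hpow : ∀ P m, l (P ^ m) = l P ^ m := by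
    intro P m
    induction m with
    | zero => simpa using hl1
    | succ m ih => rw [pow_succ, hl, ih, pow_succ]
  have e1 : (n : ℂ) * AA l n = ∑ f ∈ Mon k n, ∑ j ∈ Finset.Icc 1 n, ∑ P ∈ Irr k n,
      (if P.natDegree ∣ j ∧ P ^ (j / P.natDegree) ∣ f then (P.natDegree : ℂ) else 0) * l f := by
    rw [AA, Finset.mul_sum]
    refine Finset.sum_congr rfl fun f hf => ?_
    have := deg_eq n f hf
    simp only [← Finset.sum_mul]
    congr 1
    conv_lhs => rw [← this]
    push_cast
    rfl
  rw [e1, Finset.sum_comm]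
  refine Finset.sum_congr rfl fun j hj => ?_
  rw [Finset.mem_Icc] at hj
  rw [GG_eq l j n hj.1 hj.2, Finset.sum_comm, Finset.sum_mul]
  refine Finset.sum_congr rfl fun P hP => ?_
  rw [mem_Irr] at hP
  by_cases hd : P.natDegree ∣ j
  · simp only [hd, true_and, if_true]
    have := sum_mult l hl n j hj.2 (P ^ (j / P.natDegree)) (hP.1.pow _)
      (by rw [natDegree_pow, Nat.div_mul_cancel hd])
    rw [hpow] at this
    rw [mul_assoc, ← this, Finset.mul_sum]
    refine Finset.sum_congr rfl fun f _ => ?_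
    split_ifs <;> simp
  · simp [hd]

theorem AA_zero {k : Type*} [Field k] [Finite k] (l : k[X] → ℂ) (hl1 : l 1 = 1) : AA l 0 = 1 := by
  have : Mon k 0 = {1} := by
    ext f
    rw [mem_Mon, Finset.mem_singleton]
    constructor
    · rintro ⟨h1, h2⟩; exact h1.natDegree_eq_zero.1 h2
    · rintro rfl; exact ⟨monic_one, natDegree_one⟩
  rw [AA, this, Finset.sum_singleton, hl1]

theorem GG_pow {k : Type*} [Field k] [Finite k] (l : k[X] → ℂ)
    (hl : ∀ f g, l (f * g) = l f * l g) (hl1 : l 1 = 1) (hA : ∀ n, 2 ≤ n → AA l n = 0) (n : ℕ) :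
    GG l (n+1) = - (- AA l 1) ^ (n + 1) := by
  have h0 := AA_zero l hl1
  induction n with
  | zero =>
    have := newton l hl hl1 1
    simp [h0] at this
    simp [this]
  | succ n ih =>
    have := newton l hl hl1 (n + 2)
    rw [hA _ (by omega), mul_zero, Finset.sum_Icc_succ_top (by omega),
      Finset.sum_Icc_succ_top (by omega), Finset.sum_eq_zero] at this
    · simp only [Nat.sub_self, h0] at this
      rw [show n + 1 + 1 - (n + 1) = 1 by omega, ih] at this
      rw [pow_succ]
      linear_combination -this
    · intro j hj
      rw [Finset.mem_Icc] at hj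
      rw [hA _ (by omega), mul_zero]

theorem fiber_card_s1 {k K : Type*} [Field k] [Field K] [Finite k] [Fintype K] [Algebra k K]
    (P : k[X]) (hP : P.Monic) (hi : Irreducible P) :
    (by classical exact (Finset.univ.filter (fun x : K => minpoly k x = P)).card) =
      if P.natDegree ∣ Module.finrank k K then P.natDegree else 0 := by
  classical
  split_ifs with hd
  · have h1 := hi.natDegree_dvd_iff_dvd_X_pow_card_pow_sub_X.1 hd
    have hcard : Nat.card k ^ Module.finrank k K = Fintype.card K := by
      rw [← Nat.card_eq_fintype_card, Module.natCard_eq_pow_finrank (K := k) (V := K)]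
    rw [hcard] at h1
    have hs : (P.map (algebraMap k K)).Splits := by
      have h2 := Polynomial.map_dvd (algebraMap k K) h1
      rw [Polynomial.map_sub, Polynomial.map_pow, map_X] at h2
      refine Splits.of_dvd ?_ ?_ h2
      · have := IsSplittingField.splits K (X ^ Fintype.card K - X : k[X])
        simpa using this
      · exact FiniteField.X_pow_card_sub_X_ne_zero _ Fintype.one_lt_card
    rw [← card_rootSet_eq_natDegree (PerfectField.separable_of_irreducible hi) hs, ← Set.toFinset_card]
    congr 1
    ext x
    simp only [Finset.mem_filter, Finset.mem_univ, true_and, Set.mem_toFinset, mem_rootSet]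
    constructor
    · rintro rfl
      exact ⟨hi.ne_zero, minpoly.aeval _ _⟩
    · rintro ⟨_, h⟩
      exact (minpoly.eq_of_irreducible_of_monic hi h hP).symm
  · rw [Finset.card_eq_zero, Finset.filter_eq_empty_iff]
    rintro x - rfl
    exact hd (minpoly.degree_dvd (Algebra.IsIntegral.isIntegral x))

theorem GG_eq_sum {k K : Type*} [Field k] [Field K] [Finite k] [Fintype K] [Algebra k K]
    (l : k[X] → ℂ) :
    GG l (Module.finrank k K) =
      ∑ x : K, l (minpoly k x) ^ (Module.finrank k K / (minpoly k x).natDegree) := by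
  classical
  rw [← Finset.sum_fiberwise_of_maps_to (s := Finset.univ) (t := Irr k (Module.finrank k K))
    (g := fun x : K => minpoly k x)]
  · unfold GG
    refine Finset.sum_congr rfl fun P hP => ?_
    rw [mem_Irr] at hP
    rw [Finset.sum_congr rfl (g := fun _ => l P ^ (Module.finrank k K / P.natDegree))]
    · rw [Finset.sum_const, fiber_card_s1 P hP.1 hP.2.2, nsmul_eq_mul]
      split_ifs <;> simp
    · intro x hx
      simp only [Finset.mem_filter] at hx
      rw [hx.2]
  · intro x _
    have hx := Algebra.IsIntegral.isIntegral (R := k) x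
    rw [mem_Irr]
    exact ⟨minpoly.monic hx, minpoly.natDegree_le x, minpoly.irreducible hx⟩

def lam {k : Type*} [Field k] (χ : MulChar k ℂ) (f : k[X]) : ℂ := χ (f.eval 0) * χ (f.eval 1)

theorem AA_lam {k : Type*} [Field k] [Finite k] (χ : MulChar k ℂ) (hχ : χ ≠ 1) (n : ℕ)
    (hn : 2 ≤ n) : AA (lam χ) n = 0 := by
  obtain ⟨c, hc⟩ := MulChar.ne_one_iff.1 hχ
  have hdeg : ∀ (f : k[X]) (b : k), f ∈ Mon k n → f + C (b * f.eval 0) * (1 - X) ∈ Mon k n := by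
    intro f b hf
    rw [mem_Mon] at hf ⊢
    have h1 : (C (b * f.eval 0) * (1 - X) : k[X]).degree < f.degree := by
      rw [degree_eq_natDegree hf.1.ne_zero, hf.2]
      refine lt_of_le_of_lt (b := (1 : WithBot ℕ)) ?_ (by exact_mod_cast hn)
      compute_degree
    refine ⟨hf.1.add_of_left h1, ?_⟩
    rw [natDegree_add_eq_left_of_degree_lt h1, hf.2]
  have key : AA (lam χ) n = χ c * AA (lam χ) n := by
    unfold AA
    rw [Finset.mul_sum]
    symm
    refine Finset.sum_bij' (fun f _ => f + C (((c:k) - 1) * f.eval 0) * (1 - X))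
      (fun f _ => f + C ((((c⁻¹ : kˣ) :k) - 1) * f.eval 0) * (1 - X)) ?_ ?_ ?_ ?_ ?_
    · intro f hf; exact hdeg _ _ hf
    · intro f hf; exact hdeg _ _ hf
    · intro f hf
      simp only [eval_add, eval_mul, eval_C, eval_sub, eval_one, eval_X]
      rw [add_assoc, ← add_mul, ← C_add]
      have : ((c:k) - 1) * eval 0 f + (((c⁻¹ : kˣ) : k) - 1) * (eval 0 f + ((c:k) - 1) * eval 0 f * (1 - 0)) = 0 := by
        have := c.inv_mul
        linear_combination (eval 0 f) * this
      rw [this]; simp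
    · intro f hf
      simp only [eval_add, eval_mul, eval_C, eval_sub, eval_one, eval_X]
      rw [add_assoc, ← add_mul, ← C_add]
      have : (((c⁻¹ : kˣ):k) - 1) * eval 0 f + ((c : k) - 1) * (eval 0 f + (((c⁻¹ : kˣ):k) - 1) * eval 0 f * (1 - 0)) = 0 := by
        have := c.inv_mul
        linear_combination (eval 0 f) * this
      rw [this]; simp
    · intro f hf
      simp only [lam, eval_add, eval_mul, eval_C, eval_sub, eval_one, eval_X]
      rw [← mul_assoc, ← map_mul]
      congr 2 <;> ring_nf
  have : (1 - χ c) * AA (lam χ) n = 0 := by linear_combination key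
  rcases mul_eq_zero.1 this with h | h
  · exact absurd (sub_eq_zero.1 h).symm hc
  · exact h

theorem chi_neg_one {k : Type*} [Field k] (χ : MulChar k ℂ) (hχ : χ ^ 3 = 1) : χ (-1) = 1 := by
  have h1 : χ (-1) ^ 3 = 1 := by
    rw [← MulChar.pow_apply' χ (by norm_num), hχ, MulChar.one_apply (by simp)]
  rw [← map_pow] at h1
  rwa [show (-1 : k) ^ 3 = -1 by ring] at h1

theorem chi_norm {k K : Type*} [Field k] [Field K] [Finite k] [Finite K] [Algebra k K]
    (χ : MulChar k ℂ) (hχ : χ ^ 3 = 1) (x : K) (c : k) :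
    χ (Algebra.norm k (x - algebraMap k K c)) =
      χ ((minpoly k x).eval c) ^ (Module.finrank k K / (minpoly k x).natDegree) := by
  have hm := minpoly.sub_algebraMap (A := k) x c
  have hc : (minpoly k x).eval c = (minpoly k (x - algebraMap k K c)).coeff 0 := by
    rw [hm, coeff_zero_eq_eval_zero, eval_comp]; simp
  have hd : (minpoly k x).natDegree = (minpoly k (x - algebraMap k K c)).natDegree := by
    rw [hm, natDegree_comp]; simp
  rw [hc, hd]
  generalize x - algebraMap k K c = y
  have hy := Algebra.IsIntegral.isIntegral (R := k) y
  rw [Algebra.norm_eq_norm_adjoin]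
  have h1 : Module.finrank k K / (minpoly k y).natDegree =
      Module.finrank (IntermediateField.adjoin k {y}) K := by
    rw [← IntermediateField.adjoin.finrank hy, ← Module.finrank_mul_finrank k (IntermediateField.adjoin k {y}) K,
      Nat.mul_div_cancel_left _ Module.finrank_pos]
  rw [h1, map_pow]
  congr 1
  have h2 := Algebra.PowerBasis.norm_gen_eq_coeff_zero_minpoly (IntermediateField.adjoin.powerBasis hy)
  rw [IntermediateField.adjoin.powerBasis_gen, IntermediateField.minpoly_gen] at h2
  rw [h2, map_mul, map_pow, chi_neg_one χ hχ, one_pow, one_mul]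

/-- Hasse Davenport relation -/
theorem HD {k K : Type*} [Field k] [Field K] [Finite k] [Fintype K] [Algebra k K]
    (χ : MulChar k ℂ) (hχ : χ ^ 3 = 1) (hχ1 : χ ≠ 1) :
    ∑ x : K, χ (Algebra.norm k x) * χ (Algebra.norm k (1 - x)) =
      - (- AA (lam χ) 1) ^ (Module.finrank k K) := by
  have hp : 0 < Module.finrank k K := Module.finrank_pos
  obtain ⟨n, hn⟩ := Nat.exists_eq_succ_of_ne_zero hp.ne'
  have := GG_pow (lam χ) (by intro f g; simp [lam]; ring) (by simp [lam]) (AA_lam χ hχ1) n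
  rw [← Nat.succ_eq_add_one, ← hn] at this
  rw [← this, GG_eq_sum]
  refine Finset.sum_congr rfl fun x _ => ?_
  rw [lam, mul_pow, ← chi_norm χ hχ, ← chi_norm χ hχ]
  congr 1
  · simp
  · rw [map_one, ← neg_sub 1 x, ← neg_one_mul (1 - x), map_mul, map_mul]
    have : χ (Algebra.norm k (-1 : K)) = 1 := by
      rw [show (-1 : K) = algebraMap k K (-1) by simp, Algebra.norm_algebraMap, map_pow, chi_neg_one χ hχ, one_pow]
    rw [this, one_mul]

def cnt (R : Type*) [CommRing R] : ℕ :=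
  Nat.card {v : R × R × R // v.1 ^ 3 + v.2.1 ^ 3 + v.2.2 ^ 3 = 0}

def nn {K : Type*} [Field K] (χ : MulChar K ℂ) (a : K) : ℂ := 1 + χ a + χ⁻¹ a

theorem cube_card {K : Type*} [Field K] [Fintype K] (χ : MulChar K ℂ) (hχ : χ ^ 3 = 1)
    (hχ1 : χ ≠ 1) (a : K) :
    ((by classical exact (Finset.univ.filter (fun x : K => x ^ 3 = a)).card : ℕ) : ℂ) = nn χ a := by
  classical
  unfold nn
  by_cases ha : a = 0
  · subst ha
    have : (Finset.univ.filter (fun x : K => x ^ 3 = 0)) = {0} := by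
      ext x; simp
    rw [this, MulChar.map_zero, MulChar.map_zero]; simp
  obtain ⟨g, hg⟩ := IsCyclic.exists_generator (α := Kˣ)
  have hg1 : χ g ≠ 1 := by
    intro h
    apply hχ1
    apply MulChar.eq_one_iff.2
    intro u
    obtain ⟨m, rfl⟩ := (Subgroup.mem_zpowers_iff).1 (hg u)
    obtain ⟨m', hm'⟩ := (mem_powers_iff_mem_zpowers (x := g) (y := g ^ m)).2 (hg _)
    simp only at hm'
    rw [← hm', Units.val_pow_eq_pow_val, map_pow, h, one_pow]
  have hg3 : χ g ^ 3 = 1 := by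
    rw [← MulChar.pow_apply' χ (by norm_num), hχ, MulChar.one_apply_coe]
  have hprim : IsPrimitiveRoot (χ (g:K)) 3 := by
    have := IsPrimitiveRoot.orderOf (χ (g:K))
    rwa [orderOf_eq_prime hg3 hg1] at this
  have h3 : 3 ∣ orderOf g := by
    apply hprim.dvd_of_pow_eq_one
    rw [← map_pow, ← Units.val_pow_eq_pow_val, pow_orderOf_eq_one]
    simp
  obtain ⟨e, he⟩ := h3
  have hζ : IsPrimitiveRoot (g ^ e) 3 :=
    (IsPrimitiveRoot.orderOf g).pow (orderOf_pos g) (by rw [he, mul_comm])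
  have hζ' : IsPrimitiveRoot ((g ^ e : Kˣ) : K) 3 := IsPrimitiveRoot.coe_units_iff.2 hζ
  have hn := hζ'.card_nthRoots a
  have hnd := hζ'.nthRoots_nodup ha
  have hs : (Finset.univ.filter (fun x : K => x ^ 3 = a)) = (nthRoots 3 a).toFinset := by
    ext x; simp [mem_nthRoots]
  rw [hs, Multiset.toFinset_card_of_nodup hnd, hn]
  have hinv : χ⁻¹ a = χ a ^ 2 := by
    have : χ⁻¹ = χ ^ 2 := by
      rw [inv_eq_iff_mul_eq_one, ← hχ]; exact (pow_succ' χ 2).symm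
    rw [this, MulChar.pow_apply' χ (by norm_num)]
  rw [hinv]
  obtain ⟨m, hm⟩ := (mem_powers_iff_mem_zpowers (x := g) (y := Units.mk0 a ha)).2 (hg _)
  simp only at hm
  have hm : a = (g:K) ^ m := by
    rw [← Units.val_pow_eq_pow_val, hm]; rfl
  split_ifs with h
  · obtain ⟨b, rfl⟩ := h
    have hb : b ≠ 0 := by rintro rfl; simp at ha
    rw [map_pow, ← MulChar.pow_apply' χ (by norm_num), hχ, MulChar.one_apply (by simpa using hb)]
    norm_num
  · have hne : χ a ≠ 1 := by
      intro h1
      rw [hm, map_pow] at h1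
      obtain ⟨c, rfl⟩ := hprim.dvd_of_pow_eq_one _ h1
      exact h ⟨(g:K) ^ c, by rw [hm]; ring⟩
    have h3 : χ a ^ 3 = 1 := by
      rw [hm, map_pow, ← pow_mul, mul_comm, pow_mul, hg3, one_pow]
    have : (χ a - 1) * (1 + χ a + χ a ^ 2) = 0 := by linear_combination h3
    rcases mul_eq_zero.1 this with h | h
    · exact absurd (sub_eq_zero.1 h) hne
    · rw [h]; simp

theorem sum_cube {K : Type*} [Field K] [Fintype K] (χ : MulChar K ℂ) (hχ : χ ^ 3 = 1)
    (hχ1 : χ ≠ 1) (F : K → ℂ) : ∑ x : K, F (x ^ 3) = ∑ a : K, nn χ a * F a := by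
  classical
  rw [← Finset.sum_fiberwise_of_maps_to (s := Finset.univ) (t := Finset.univ)
    (g := fun x : K => x ^ 3) (fun _ _ => Finset.mem_univ _)]
  refine Finset.sum_congr rfl fun a _ => ?_
  rw [← cube_card χ hχ hχ1, Finset.sum_congr rfl (g := fun _ => F a)]
  · rw [Finset.sum_const, nsmul_eq_mul]
  · intro x hx
    simp only [Finset.mem_filter] at hx
    rw [hx.2]

theorem cnt_eq {K : Type*} [Field K] [Fintype K] (χ : MulChar K ℂ) (hχ : χ ^ 3 = 1)
    (hχ1 : χ ≠ 1) : (cnt K : ℂ) = (Fintype.card K : ℂ) ^ 2 +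
      ((Fintype.card K : ℂ) - 1) * (jacobiSum χ χ + jacobiSum χ⁻¹ χ⁻¹) := by
  classical
  have hinv1 : χ⁻¹ ≠ 1 := by simpa using hχ1
  have hm1 := chi_neg_one χ hχ
  have hm1' : χ⁻¹ (-1) = 1 := chi_neg_one χ⁻¹ (by rw [inv_pow, hχ, inv_one])
  have e1 : (cnt K : ℂ) = ∑ z : K, ∑ a : K, nn χ a * nn χ (-z ^ 3 - a) := by
    have : ∀ z : K, ∑ a : K, nn χ a * nn χ (-z ^ 3 - a) =
        ∑ x : K, ∑ y : K, if z ^ 3 + x ^ 3 + y ^ 3 = 0 then (1:ℂ) else 0 := by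
      intro z
      rw [← sum_cube χ hχ hχ1 (fun a => nn χ (-z ^ 3 - a))]
      refine Finset.sum_congr rfl fun x _ => ?_
      rw [← cube_card χ hχ hχ1, Finset.sum_boole]
      congr 3
      ext y
      constructor
      · intro h; linear_combination h
      · intro h; linear_combination h
    rw [Finset.sum_congr rfl fun z _ => this z, cnt, Nat.card_eq_fintype_card, Fintype.card_subtype,
      ← Finset.sum_boole, Fintype.sum_prod_type]
    refine Finset.sum_congr rfl fun x _ => ?_
    rw [Fintype.sum_prod_type]
  have s1 : ∑ a, χ a = 0 := MulChar.sum_eq_zero_of_ne_one hχ1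
  have s2 : ∑ a, χ⁻¹ a = 0 := MulChar.sum_eq_zero_of_ne_one hinv1
  have U1 : ∑ a : K, nn χ a * nn χ (1 - a) = (Fintype.card K : ℂ) - 2 +
      (jacobiSum χ χ + jacobiSum χ⁻¹ χ⁻¹) := by
    have j1 := jacobiSum_nontrivial_inv hχ1
    have j2 := jacobiSum_nontrivial_inv hinv1
    rw [inv_inv] at j2
    rw [hm1] at j1
    rw [hm1'] at j2
    have s1' : ∑ a, χ (1 - a) = 0 := by
      rw [← s1]; exact (Equiv.subLeft (1:K)).sum_comp χ
    have s2' : ∑ a, χ⁻¹ (1 - a) = 0 := by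
      rw [← s2]; exact (Equiv.subLeft (1:K)).sum_comp (fun a => χ⁻¹ a)
    have : ∀ a : K, nn χ a * nn χ (1 - a) = 1 + χ a + χ⁻¹ a + χ (1 - a) + χ⁻¹ (1 - a) +
      χ a * χ (1 - a) + χ⁻¹ a * χ⁻¹ (1 - a) + χ a * χ⁻¹ (1 - a) + χ⁻¹ a * χ (1 - a) := by
      intro a; unfold nn; ring
    rw [Finset.sum_congr rfl fun a _ => this a]
    simp only [Finset.sum_add_distrib, s1, s2, s1', s2']
    unfold jacobiSum at *
    rw [j1, j2]
    simp
    ring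
  have U0 : ∑ a : K, nn χ a * nn χ (0 - a) = 3 * (Fintype.card K : ℂ) - 2 := by
    have h2 : χ * χ = χ⁻¹ := by
      rw [eq_inv_iff_mul_eq_one, ← hχ, pow_succ, pow_two]
    have h2' : χ⁻¹ * χ⁻¹ = χ := by rw [← mul_inv, h2, inv_inv]
    have : ∀ a : K, nn χ a * nn χ (0 - a) = 1 + 2 * (1 : MulChar K ℂ) a + 3 * χ a + 3 * χ⁻¹ a := by
      intro a
      have ea : χ (0 - a) = χ a := by rw [zero_sub, ← neg_one_mul, map_mul, hm1, one_mul]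
      have eb : χ⁻¹ (0 - a) = χ⁻¹ a := by rw [zero_sub, ← neg_one_mul, map_mul, hm1', one_mul]
      have ec : χ a * χ a = χ⁻¹ a := by rw [← MulChar.mul_apply, h2]
      have ed : χ⁻¹ a * χ⁻¹ a = χ a := by rw [← MulChar.mul_apply, h2']
      have ee : χ a * χ⁻¹ a = (1 : MulChar K ℂ) a := by rw [← MulChar.mul_apply, mul_inv_cancel]
      unfold nn
      rw [ea, eb]
      linear_combination ec + ed + 2 * ee
    rw [Finset.sum_congr rfl fun a _ => this a]
    simp only [Finset.sum_add_distrib, ← Finset.mul_sum, s1, s2]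
    rw [MulChar.sum_one_eq_card_units, Fintype.card_units, Nat.cast_sub Fintype.card_pos]
    simp
    ring
  have Uz : ∀ z : K, z ≠ 0 → ∑ a : K, nn χ a * nn χ (-z ^ 3 - a) = ∑ a : K, nn χ a * nn χ (1 - a) := by
    intro z hz
    have hz3 : -z ^ 3 ≠ 0 := neg_ne_zero.2 (pow_ne_zero 3 hz)
    rw [← Equiv.sum_comp (Equiv.mulLeft₀ (-z ^ 3) hz3)]
    have hcu : ∀ ψ : MulChar K ℂ, ψ ^ 3 = 1 → ψ (-z ^ 3) = 1 := by
      intro ψ h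
      rw [show -z ^ 3 = (-z) ^ 3 by ring, map_pow, ← MulChar.pow_apply' ψ (by norm_num), h,
        MulChar.one_apply (by simpa using hz)]
    have hnn : ∀ b, nn χ (-z ^ 3 * b) = nn χ b := by
      intro b
      unfold nn
      rw [map_mul, map_mul, hcu χ hχ, hcu χ⁻¹ (by rw [inv_pow, hχ, inv_one]), one_mul, one_mul]
    refine Finset.sum_congr rfl fun a _ => ?_
    change nn χ (-z ^ 3 * a) * nn χ (-z ^ 3 - -z ^ 3 * a) = _
    rw [hnn, show -z ^ 3 - -z ^ 3 * a = -z ^ 3 * (1 - a) by ring, hnn]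
  rw [e1, ← Finset.add_sum_erase _ _ (Finset.mem_univ (0:K)),
    Finset.sum_congr rfl (fun z hz => Uz z (Finset.ne_of_mem_erase hz)), Finset.sum_const,
    Finset.card_erase_of_mem (Finset.mem_univ _), Finset.card_univ, nsmul_eq_mul,
    Nat.cast_sub Fintype.card_pos, show (-0 ^ 3 : K) = 0 by simp, U0, U1]
  push_cast
  ring

theorem jac_conj {K : Type*} [Field K] [Fintype K] (χ : MulChar K ℂ) :
    jacobiSum χ⁻¹ χ⁻¹ = starRingEnd ℂ (jacobiSum χ χ) := by
  unfold jacobiSum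
  rw [map_sum]
  refine Finset.sum_congr rfl fun x _ => ?_
  rw [map_mul, ← MulChar.star_eq_inv]
  rfl

/-- norm-composed character -/
def normChar (k K : Type*) [Field k] [Field K] [Algebra k K] [FiniteDimensional k K]
    (χ : MulChar k ℂ) : MulChar K ℂ where
  toMonoidHom := (χ.toMonoidHom).comp (Algebra.norm k)
  map_nonunit' := by
    intro a ha
    have : a = 0 := by simpa using ha
    subst this
    simpa using χ.map_zero

theorem main_count (k : Type*) [Field k] [Fintype k] (h3 : 3 ∣ Fintype.card k - 1) :
    ∃ β : ℂ, ‖β‖ ^ 2 = Fintype.card k ∧ ∀ (K : Type) [Field K] [Fintype K] [Algebra k K],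
      (cnt K : ℝ) = (Fintype.card K : ℝ) ^ 2 -
        ((Fintype.card K : ℝ) - 1) * (2 * (β ^ Module.finrank k K).re) := by
  obtain ⟨χ, hχo⟩ := MulChar.exists_mulChar_orderOf k h3
    (Complex.isPrimitiveRoot_exp 3 (by norm_num))
  have hχ : χ ^ 3 = 1 := by rw [← hχo, pow_orderOf_eq_one]
  have hχ1 : χ ≠ 1 := by rintro rfl; simp at hχo
  have hJ : ∀ (K : Type _) [Field K] [Fintype K] [Algebra k K],
      jacobiSum (normChar k K χ) (normChar k K χ) = - (- AA (lam χ) 1) ^ (Module.finrank k K) := by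
    intro K _ _ _
    rw [← HD χ hχ hχ1]
    rfl
  have hJk : jacobiSum χ χ = AA (lam χ) 1 := by
    have := HD (K := k) χ hχ hχ1
    simpa [jacobiSum, Algebra.norm_self] using this
  refine ⟨- AA (lam χ) 1, ?_, ?_⟩
  · have hne : χ * χ ≠ 1 := by
      intro h
      have : orderOf χ ∣ 2 := orderOf_dvd_of_pow_eq_one (by rw [pow_two, h])
      rw [hχo] at this
      norm_num at this
    have hr : ringChar ℂ ≠ ringChar k := by
      rw [ringChar.eq_zero]
      exact (CharP.ringChar_ne_zero_of_finite k).symm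
    have := jacobiSum_mul_jacobiSum_inv hr hχ1 hχ1 hne
    rw [jac_conj, Complex.mul_conj, hJk] at this
    rw [norm_neg, ← Complex.normSq_eq_norm_sq]
    exact_mod_cast this
  · intro K _ _ _
    have hn3 : (normChar k K χ) ^ 3 = 1 := by
      ext u
      rw [MulChar.pow_apply_coe, MulChar.one_apply_coe]
      change χ (Algebra.norm k (u : K)) ^ 3 = 1
      rw [← MulChar.pow_apply' χ (by norm_num), hχ, MulChar.one_apply]
      simp
    have hn1 : normChar k K χ ≠ 1 := by
      obtain ⟨c, hc⟩ := MulChar.ne_one_iff.1 hχ1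
      obtain ⟨y, hy⟩ := FiniteField.unitsMap_norm_surjective k K c
      refine MulChar.ne_one_iff.2 ⟨y, ?_⟩
      change χ (Algebra.norm k (y : K)) ≠ 1
      rw [← hy] at hc
      exact hc
    have := cnt_eq _ hn3 hn1
    rw [jac_conj, hJ K, Complex.add_conj] at this
    apply Complex.ofReal_injective
    push_cast
    rw [this]
    simp only [Complex.neg_re]
    push_cast
    ring

theorem recur (β : ℂ) (N : ℕ) :
    ∃ m, N ≤ m ∧ ‖β‖ ^ m ≤ 2 * (β ^ m).re := by
  obtain ⟨j, hj0, hj5, hj⟩ := Real.exists_nat_abs_mul_sub_round_le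
    ((N : ℝ) * β.arg / (2 * Real.pi)) (n := 5) (by norm_num)
  refine ⟨j * N, Nat.le_mul_of_pos_left N hj0, ?_⟩
  have hpi := Real.pi_pos
  have h1 : (β ^ (j * N)).re = ‖β‖ ^ (j * N) * Real.cos (((j * N : ℕ) : ℝ) * β.arg) := by
    conv_lhs => rw [← Complex.norm_mul_exp_arg_mul_I β]
    rw [mul_pow, ← Complex.exp_nat_mul, ← Complex.ofReal_pow, Complex.re_ofReal_mul]
    congr 1
    rw [← mul_assoc, ← Complex.ofReal_natCast, ← Complex.ofReal_mul, Complex.exp_ofReal_mul_I_re]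
  set r := round ((j : ℝ) * ((N : ℝ) * β.arg / (2 * Real.pi))) with hr
  have h2 : |((j * N : ℕ) : ℝ) * β.arg - r * (2 * Real.pi)| ≤ Real.pi / 3 := by
    have : ((j * N : ℕ) : ℝ) * β.arg - r * (2 * Real.pi) =
        (2 * Real.pi) * ((j : ℝ) * ((N : ℝ) * β.arg / (2 * Real.pi)) - r) := by
      push_cast; field_simp
    rw [this, abs_mul, abs_of_pos (by positivity)]
    calc _ ≤ 2 * Real.pi * (1 / ((5:ℕ) + 1)) := by gcongr
      _ = Real.pi / 3 := by push_cast; ring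
  have h3 : 1 / 2 ≤ Real.cos (((j * N : ℕ) : ℝ) * β.arg) := by
    rw [← Real.cos_sub_int_mul_two_pi _ r, ← Real.cos_abs, ← Real.cos_pi_div_three]
    apply Real.cos_le_cos_of_nonneg_of_le_pi (abs_nonneg _) _ h2
    linarith
  rw [h1]
  have : 0 ≤ ‖β‖ ^ (j * N) := by positivity
  nlinarith

theorem cnt_congr {R S : Type*} [CommRing R] [CommRing S] (e : R ≃+* S) : cnt R = cnt S := by
  unfold cnt
  refine Nat.card_congr (Equiv.subtypeEquiv
    (e.toEquiv.prodCongr (e.toEquiv.prodCongr e.toEquiv)) ?_)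
  rintro ⟨x, y, z⟩
  simp only [Equiv.prodCongr_apply, Prod.map, RingEquiv.toEquiv_eq_coe, EquivLike.coe_coe]
  rw [← map_pow, ← map_pow, ← map_pow, ← map_add, ← map_add, map_eq_zero_iff _ e.injective]

theorem cnt_pi {ι : Type*} [Fintype ι] (R : ι → Type*) [∀ i, CommRing (R i)] :
    cnt (∀ i, R i) = ∏ i, cnt (R i) := by
  unfold cnt
  rw [← Nat.card_pi]
  refine Nat.card_congr
    { toFun := fun v i => ⟨(v.1.1 i, v.1.2.1 i, v.1.2.2 i), congrFun v.2 i⟩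
      invFun := fun w => ⟨(fun i => (w i).1.1, fun i => (w i).1.2.1, fun i => (w i).1.2.2),
        funext fun i => (w i).2⟩
      left_inv := fun v => rfl
      right_inv := fun w => rfl }

theorem sum_Irr {k : Type*} [Field k] [Finite k] (n N : ℕ) (hn : 0 < n) (h : n ≤ N) :
    (∑ P ∈ Irr k N, if P.natDegree ∣ n then P.natDegree else 0) = Nat.card k ^ n := by
  obtain ⟨p, hp⟩ := CharP.exists k
  have : Fact (Nat.Prime p) := ⟨CharP.char_is_prime k p⟩
  have : NeZero n := ⟨hn.ne'⟩
  let K := FiniteField.Extension k p n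
  have : Fintype K := Fintype.ofFinite K
  have e := GG_eq_sum (K := K) (fun _ : k[X] => (1:ℂ))
  rw [show Module.finrank k K = n from FiniteField.finrank_extension k p n, GG_eq _ n N hn h] at e
  simp only [one_pow, mul_one, Finset.sum_const, nsmul_eq_mul] at e
  rw [Finset.card_univ, ← Nat.card_eq_fintype_card,
    show Nat.card K = _ from FiniteField.natCard_extension k p n] at e
  exact_mod_cast e

theorem card_Irr {k : Type*} [Field k] [Finite k] (m : ℕ) (hm : 0 < m) :
    Nat.card k ^ (2 * m) ≤ 2 * m * ((Irr k (2 * m)).filter (fun P => P.natDegree = 2 * m)).card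
      + m * Nat.card k ^ m := by
  have hq : 0 < Nat.card k := Nat.card_pos
  rw [← sum_Irr (k := k) (2 * m) (2 * m) (by omega) le_rfl,
    ← Finset.sum_filter_add_sum_filter_not _ (fun P => P.natDegree = 2 * m)]
  apply add_le_add
  · refine (Finset.sum_le_card_nsmul _ _ (2 * m) ?_).trans (by rw [smul_eq_mul, mul_comm])
    intro P hP
    rw [Finset.mem_filter] at hP
    rw [hP.2]; split_ifs <;> omega
  · calc _ ≤ ∑ P ∈ Irr k m, P.natDegree := by
          rw [← Finset.sum_filter]
          apply Finset.sum_le_sum_of_subset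
          intro P hP
          simp only [Finset.mem_filter, mem_Irr] at hP
          obtain ⟨⟨⟨h1, h2, h3⟩, h4⟩, e, he⟩ := hP
          rw [mem_Irr]
          refine ⟨h1, ?_, h3⟩
          rcases e with _ | _ | e
          · omega
          · omega
          · nlinarith
      _ ≤ ∑ P ∈ Irr k m, ∑ d ∈ Finset.Icc 1 m, if P.natDegree ∣ d then P.natDegree else 0 := by
          apply Finset.sum_le_sum
          intro P hP
          rw [mem_Irr] at hP
          have := Finset.single_le_sum (f := fun d => if P.natDegree ∣ d then P.natDegree else 0)
            (fun _ _ => Nat.zero_le _) (Finset.mem_Icc.2 ⟨hP.2.2.natDegree_pos, hP.2.1⟩)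
          simpa using this
      _ = ∑ d ∈ Finset.Icc 1 m, Nat.card k ^ d := by
          rw [Finset.sum_comm]
          refine Finset.sum_congr rfl fun d hd => ?_
          rw [Finset.mem_Icc] at hd
          exact sum_Irr d m hd.1 hd.2
      _ ≤ ∑ d ∈ Finset.Icc 1 m, Nat.card k ^ m := by
          apply Finset.sum_le_sum
          intro d hd
          rw [Finset.mem_Icc] at hd
          exact Nat.pow_le_pow_right hq hd.2
      _ = m * Nat.card k ^ m := by simp

theorem cnt_prod {k : Type*} [Field k] [Finite k] (S : Finset k[X])
    (hS : ∀ P ∈ S, P.Monic ∧ Irreducible P) :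
    cnt (k[X] ⧸ Ideal.span {∏ P ∈ S, P}) = ∏ P ∈ S, cnt (k[X] ⧸ Ideal.span {P}) := by
  have hco : Pairwise (Function.onFun IsCoprime fun P : S => Ideal.span {(P : k[X])}) := by
    intro P Q hPQ
    change IsCoprime (Ideal.span {(P : k[X])}) (Ideal.span {(Q : k[X])})
    rw [Ideal.isCoprime_span_singleton_iff]
    have hP := hS P P.2
    have hQ := hS Q Q.2
    rw [hP.2.coprime_iff_not_dvd]
    intro hd
    apply hPQ
    apply Subtype.ext
    exact eq_of_monic_of_associated hP.1 hQ.1 (hP.2.associated_of_dvd hQ.2 hd)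
  have e := Ideal.quotientInfRingEquivPiQuotient _ hco
  have hI : (⨅ P : S, Ideal.span {(P : k[X])}) = Ideal.span {∏ P ∈ S, P} := by
    rw [Ideal.iInf_span_singleton]
    · rw [Finset.prod_coe_sort S (fun P => P)]
    · intro P Q hPQ
      have := hco hPQ
      exact (Ideal.isCoprime_span_singleton_iff _ _).1 this
  rw [hI] at e
  rw [cnt_congr e, cnt_pi]
  exact Finset.prod_coe_sort S (fun P => cnt (k[X] ⧸ Ideal.span {P}))

theorem cnt_prime {k : Type*} [Field k] [Fintype k] (P : k[X]) (hP : Irreducible P)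
    (K : Type*) [Field K] [Fintype K] (hc : Fintype.card K = Fintype.card k ^ P.natDegree) :
    cnt (k[X] ⧸ Ideal.span {P}) = cnt K := by
  have : Fact (Irreducible P) := ⟨hP⟩
  have hfd : FiniteDimensional k (AdjoinRoot P) := (AdjoinRoot.powerBasis hP.ne_zero).finite
  have : Finite (AdjoinRoot P) := Module.finite_of_finite k
  have : Fintype (AdjoinRoot P) := Fintype.ofFinite _
  have h1 : Fintype.card (AdjoinRoot P) = Fintype.card K := by
    rw [hc, ← Nat.card_eq_fintype_card, Module.natCard_eq_pow_finrank (K := k),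
      (AdjoinRoot.powerBasis hP.ne_zero).finrank, AdjoinRoot.powerBasis_dim,
      Nat.card_eq_fintype_card]
  exact cnt_congr (R := AdjoinRoot P) (FiniteField.ringEquivOfCardEq h1)

theorem sq_le_two_pow (m : ℕ) (hm : 4 ≤ m) : m ^ 2 ≤ 2 ^ m := by
  induction m, hm using Nat.le_induction with
  | base => norm_num
  | succ m hm ih => rw [pow_succ 2]; nlinarith

end

/-- Suppose `char(F_q) ≠ 3`. For every `ε > 0` there exists a monic polynomial
`r ∈ F_q[t]` such that `ρ(r) < ε·|r|²`, where
`ρ(r) = #{(x,y,z) ∈ (O/rO)³ : x³ + y³ + z³ = 0}` and `|r| = q^{deg r}`. -/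
theorem exists_monic_rho_lt (Fq : Type*) [Field Fq] [Fintype Fq]
    (hchar : ringChar Fq ≠ 3) :
    ∀ ε : ℝ, 0 < ε → ∃ r : Polynomial Fq, r.Monic ∧
      (Nat.card {v : (Polynomial Fq ⧸ Ideal.span {r}) × (Polynomial Fq ⧸ Ideal.span {r}) ×
          (Polynomial Fq ⧸ Ideal.span {r}) //
          v.1 ^ 3 + v.2.1 ^ 3 + v.2.2 ^ 3 = 0} : ℝ) <
        ε * ((Fintype.card Fq : ℝ) ^ r.natDegree) ^ 2 := by
  intro ε hε
  obtain ⟨p, hp⟩ := CharP.exists Fq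
  have hpp : Fact (Nat.Prime p) := ⟨CharP.char_is_prime Fq p⟩
  set q := Fintype.card Fq with hq
  have hq2 : 2 ≤ q := Fintype.one_lt_card
  let k := FiniteField.Extension Fq p 2
  have : Fintype k := Fintype.ofFinite k
  have hk : Fintype.card k = q ^ 2 := by
    rw [← Nat.card_eq_fintype_card, show Nat.card k = _ from FiniteField.natCard_extension Fq p 2,
      Nat.card_eq_fintype_card]
  have h3q : ¬ 3 ∣ q := by
    obtain ⟨n, _, hn⟩ := FiniteField.card Fq p
    intro h
    rw [hq, hn] at h
    have := (Nat.prime_dvd_prime_iff_eq Nat.prime_three hpp.out).1 (Nat.prime_three.dvd_of_dvd_pow h)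
    apply hchar
    rw [ringChar.eq Fq p, ← this]
  have h3k : 3 ∣ Fintype.card k - 1 := by
    rw [hk]
    have h1 : q % 3 = 1 ∨ q % 3 = 2 := by omega
    have h2 : q ^ 2 % 3 = 1 := by
      rcases h1 with h | h <;> simp [Nat.pow_mod, h]
    omega
  obtain ⟨β, hβ, hcount⟩ := main_count k h3k
  have hβq : ‖β‖ = q := by
    rw [hk] at hβ
    push_cast at hβ
    exact (sq_eq_sq₀ (norm_nonneg _) (by positivity)).1 hβ
  obtain ⟨N, hN⟩ := exists_nat_gt (1 + 4 * Real.log (1 / ε))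
  obtain ⟨m, hm, hre⟩ := recur β (N + 4)
  have hm4 : 4 ≤ m := by omega
  have : NeZero m := ⟨by omega⟩
  obtain ⟨p', hp'⟩ := CharP.exists k
  have : Fact (Nat.Prime p') := ⟨CharP.char_is_prime k p'⟩
  let K := FiniteField.Extension k p' m
  have : Fintype K := Fintype.ofFinite K
  have hK : Fintype.card K = q ^ (2 * m) := by
    rw [← Nat.card_eq_fintype_card, show Nat.card K = _ from FiniteField.natCard_extension k p' m,
      Nat.card_eq_fintype_card, hk, pow_mul]
  have hcK := hcount K
  rw [show Module.finrank k K = m from FiniteField.finrank_extension k p' m, hK] at hcK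
  rw [hβq] at hre
  set s : ℝ := (q : ℝ) ^ m with hs
  have hms : (m : ℝ) ^ 2 ≤ s := by
    have h1 := sq_le_two_pow m hm4
    have h2 : 2 ^ m ≤ q ^ m := Nat.pow_le_pow_left hq2 m
    rw [hs]
    exact_mod_cast h1.trans h2
  have hmR : (4 : ℝ) ≤ m := by exact_mod_cast hm4
  have hs4 : 4 ≤ s := by nlinarith
  have hs0 : 0 < s := by linarith
  have hQ : ((q ^ (2 * m) : ℕ) : ℝ) = s ^ 2 := by
    rw [hs]; push_cast; rw [← pow_mul, mul_comm]
  rw [hQ] at hcK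
  have hc1 : (cnt K : ℝ) ≤ s ^ 4 * Real.exp (-(1 / (2 * s))) := by
    have h1 : 1 - 1 / (2 * s) ≤ Real.exp (-(1 / (2 * s))) := by
      have := Real.add_one_le_exp (-(1 / (2 * s)))
      linarith
    have h2 : (cnt K : ℝ) ≤ s ^ 4 - (s ^ 2 - 1) * s := by
      rw [hcK]
      have : (s ^ 2 - 1) * s ≤ (s ^ 2 - 1) * (2 * (β ^ m).re) := by
        apply mul_le_mul_of_nonneg_left hre; nlinarith
      nlinarith
    have h3 : s ^ 4 - (s ^ 2 - 1) * s ≤ s ^ 4 * (1 - 1 / (2 * s)) := by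
      have : s ^ 4 * (1 - 1 / (2 * s)) = s ^ 4 - s ^ 3 / 2 := by field_simp
      rw [this]
      nlinarith [pow_pos hs0 2]
    exact h2.trans (h3.trans (mul_le_mul_of_nonneg_left h1 (by positivity)))
  set S := (Irr Fq (2 * m)).filter (fun P => P.natDegree = 2 * m) with hS
  have hSm : ∀ P ∈ S, P.Monic ∧ Irreducible P ∧ P.natDegree = 2 * m := by
    intro P hP
    rw [hS, Finset.mem_filter, mem_Irr] at hP
    exact ⟨hP.1.1, hP.1.2.2, hP.2⟩
  have hcard := card_Irr (k := Fq) m (by omega)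
  rw [← hS, Nat.card_eq_fintype_card, ← hq] at hcard
  have hcard' : s ^ 2 ≤ 2 * m * (S.card : ℝ) + m * s := by
    rw [← hQ, hs]; exact_mod_cast hcard
  have hSl : ((m : ℝ) - 1) / 4 ≤ S.card * (1 / (2 * s)) := by
    rw [mul_one_div, div_le_div_iff₀ (by norm_num) (by positivity)]
    have : (m : ℝ) * (((m : ℝ) - 1) * (2 * s)) ≤ m * ((S.card : ℝ) * 4) := by nlinarith
    exact le_of_mul_le_mul_left this (by linarith)
  refine ⟨∏ P ∈ S, P, monic_prod_of_monic _ _ fun P hP => (hSm P hP).1, ?_⟩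
  have hdeg : (∏ P ∈ S, P).natDegree = S.card * (2 * m) := by
    rw [natDegree_prod_of_monic _ _ fun P hP => (hSm P hP).1,
      Finset.sum_congr rfl fun P hP => (hSm P hP).2.2, Finset.sum_const, smul_eq_mul]
  have hprod : cnt (Fq[X] ⧸ Ideal.span {∏ P ∈ S, P}) = cnt K ^ S.card := by
    rw [cnt_prod S fun P hP => ⟨(hSm P hP).1, (hSm P hP).2.1⟩, Finset.prod_congr rfl
      fun P hP => cnt_prime P (hSm P hP).2.1 K (by rw [hK, (hSm P hP).2.2]), Finset.prod_const]
  change ((cnt (Fq[X] ⧸ Ideal.span {∏ P ∈ S, P}) : ℕ) : ℝ) < _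
  rw [hprod, hdeg]
  have hnorm : (((q : ℝ) ^ (S.card * (2 * m))) ^ 2) = (s ^ 4) ^ S.card := by
    rw [hs]; ring
  rw [hnorm]
  push_cast
  calc (cnt K : ℝ) ^ S.card ≤ (s ^ 4 * Real.exp (-(1 / (2 * s)))) ^ S.card := by gcongr
    _ = Real.exp (-(S.card * (1 / (2 * s)))) * (s ^ 4) ^ S.card := by
      rw [mul_pow, ← Real.exp_nat_mul, mul_comm]; congr 2; ring
    _ < ε * (s ^ 4) ^ S.card := by
      apply mul_lt_mul_of_pos_right _ (by positivity)
      rw [← Real.lt_log_iff_exp_lt hε]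
      have : Real.log (1 / ε) = - Real.log ε := by rw [one_div, Real.log_inv]
      rw [this] at hN
      have : ((N : ℝ) + 4) ≤ m := by exact_mod_cast hm
      linarith
end

section
/- Suppose char(F_q) ≠ 3 and fix A ≥ 0. There exists a constant C > 0, depending only on q and A, such that for every integer T ≥ 1 and every monic r ∈ F_q[t] with 3·deg r ≤ T, one has (|r|/q^T) · #{k ∈ S_A : |k| < q^T and r divides k} ≤ C · ρ(r)/|r|². -/
open Polynomial
open scoped Classical

lemma natDegree_lt_of_degR {Fq : Type*} [Field Fq] {A : ℝ} {T : ℕ}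
    {k x : Polynomial Fq} (hk : k.degree < (T : WithBot ℕ))
    (h : 3 * degR x ≤ degR k + ((3 * A : ℝ) : EReal)) :
    x.natDegree < T / 3 + ⌈A⌉₊ + 1 := by
  by_cases hx : x = 0
  · subst hx; simp
  by_cases hk0 : k = 0
  · subst hk0
    exfalso
    simp only [degR, hx, if_true, if_false, EReal.bot_add, le_bot_iff] at h
    have h2 : (3 : EReal) * (x.natDegree : EReal) = ((3 * x.natDegree : ℝ) : EReal) := by
      push_cast; rfl
    rw [h2] at h
    exact EReal.coe_ne_bot _ h
  · simp only [degR, hx, hk0, if_false] at h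
    have h2 : (3 : EReal) * (x.natDegree : EReal) = ((3 * x.natDegree : ℝ) : EReal) := by
      push_cast; rfl
    have h3 : (k.natDegree : EReal) + ((3 * A : ℝ) : EReal)
        = ((k.natDegree + 3 * A : ℝ) : EReal) := by
      push_cast; rfl
    rw [h2, h3, EReal.coe_le_coe_iff] at h
    have h4 : k.natDegree < T := (natDegree_lt_iff_degree_lt hk0).2 hk
    have h5 : A ≤ ⌈A⌉₊ := Nat.le_ceil A
    have h6 : (3 * x.natDegree : ℝ) ≤ ((k.natDegree + 3 * ⌈A⌉₊ : ℕ) : ℝ) := by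
      push_cast; linarith
    have h7 : 3 * x.natDegree ≤ k.natDegree + 3 * ⌈A⌉₊ := by exact_mod_cast h6
    omega

lemma divByMonic_mem {Fq : Type*} [Field Fq] {N : ℕ} {x r : Polynomial Fq} (hr : r.Monic)
    (hd : r.natDegree < N) (hx : x.natDegree < N) :
    x /ₘ r ∈ degreeLT Fq (N - r.natDegree) := by
  rw [mem_degreeLT]
  refine lt_of_le_of_lt degree_le_natDegree ?_
  rw [natDegree_divByMonic _ hr]
  exact_mod_cast (by omega)

lemma eq_of_mk_div {Fq : Type*} [Field Fq] {x y r : Polynomial Fq} (hr : r.Monic)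
    (h1 : Ideal.Quotient.mk (Ideal.span {r}) x = Ideal.Quotient.mk (Ideal.span {r}) y)
    (h2 : x /ₘ r = y /ₘ r) : x = y := by
  rw [Ideal.Quotient.eq, Ideal.mem_span_singleton] at h1
  have h3 : (x - y) %ₘ r = 0 := (modByMonic_eq_zero_iff_dvd hr).2 h1
  rw [sub_modByMonic, sub_eq_zero] at h3
  rw [← modByMonic_add_div x r, ← modByMonic_add_div y r, h2, h3]

lemma finite_quot {Fq : Type*} [Field Fq] [Fintype Fq] {r : Polynomial Fq} (hr : r.Monic) :
    Finite (Polynomial Fq ⧸ Ideal.span {r}) := by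
  have := hr.finite_adjoinRoot
  have : Finite (AdjoinRoot r) := Module.finite_of_finite Fq
  exact this

lemma card_degreeLT' (Fq : Type*) [Field Fq] [Fintype Fq] (n : ℕ) :
    Nat.card (degreeLT Fq n) = Fintype.card Fq ^ n := by
  rw [Nat.card_congr (degreeLTEquiv Fq n).toEquiv]; simp

lemma count_bound (Fq : Type*) [Field Fq] [Fintype Fq] (A : ℝ) (T : ℕ) (r : Polynomial Fq)
    (hr : r.Monic) (hT : 3 * r.natDegree ≤ T) :
    Nat.card {k : Polynomial Fq // SA A k ∧ k.degree < (T : WithBot ℕ) ∧ r ∣ k} ≤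
      Nat.card {v : (Polynomial Fq ⧸ Ideal.span {r}) × (Polynomial Fq ⧸ Ideal.span {r}) ×
            (Polynomial Fq ⧸ Ideal.span {r}) //
            v.1 ^ 3 + v.2.1 ^ 3 + v.2.2 ^ 3 = 0} *
      (Fintype.card Fq ^ (T / 3 + ⌈A⌉₊ + 1 - r.natDegree)) ^ 3 := by
  have hd : r.natDegree < T / 3 + ⌈A⌉₊ + 1 := by omega
  set N := T / 3 + ⌈A⌉₊ + 1 with hN
  have hfin := finite_quot hr
  have hD : Finite (degreeLT Fq (N - r.natDegree)) :=
    Finite.of_equiv _ (degreeLTEquiv Fq (N - r.natDegree)).toEquiv.symm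
  have key : ∀ k : {k : Polynomial Fq // SA A k ∧ k.degree < (T : WithBot ℕ) ∧ r ∣ k},
      ∃ x y z : Polynomial Fq, x ^ 3 + y ^ 3 + z ^ 3 = k.1 ∧
        x.natDegree < N ∧ y.natDegree < N ∧ z.natDegree < N := by
    rintro ⟨k, ⟨x, y, z, h, hx, hy, hz⟩, hk, -⟩
    exact ⟨x, y, z, h, natDegree_lt_of_degR hk hx, natDegree_lt_of_degR hk hy,
      natDegree_lt_of_degR hk hz⟩
  choose x y z h hx hy hz using key
  let π := Ideal.Quotient.mk (Ideal.span {r})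
  have hv : ∀ k, (π (x k)) ^ 3 + (π (y k)) ^ 3 + (π (z k)) ^ 3 = 0 := by
    intro k
    rw [← map_pow, ← map_pow, ← map_pow, ← map_add, ← map_add, h k]
    exact Ideal.Quotient.eq_zero_iff_mem.2 (Ideal.mem_span_singleton.2 k.2.2.2)
  let f : {k : Polynomial Fq // SA A k ∧ k.degree < (T : WithBot ℕ) ∧ r ∣ k} →
      {v : (Polynomial Fq ⧸ Ideal.span {r}) × (Polynomial Fq ⧸ Ideal.span {r}) ×
            (Polynomial Fq ⧸ Ideal.span {r}) //
            v.1 ^ 3 + v.2.1 ^ 3 + v.2.2 ^ 3 = 0} ×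
      (degreeLT Fq (N - r.natDegree) × degreeLT Fq (N - r.natDegree) ×
        degreeLT Fq (N - r.natDegree)) := fun k =>
    (⟨(π (x k), π (y k), π (z k)), hv k⟩, ⟨x k /ₘ r, divByMonic_mem hr hd (hx k)⟩,
      ⟨y k /ₘ r, divByMonic_mem hr hd (hy k)⟩, ⟨z k /ₘ r, divByMonic_mem hr hd (hz k)⟩)
  have hf : Function.Injective f := by
    intro k l hkl
    simp only [f, Prod.mk.injEq, Subtype.mk.injEq] at hkl
    obtain ⟨⟨a, b, c⟩, a', b', c'⟩ := hkl
    apply Subtype.ext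
    rw [← h k, ← h l, eq_of_mk_div hr a a', eq_of_mk_div hr b b', eq_of_mk_div hr c c']
  refine (Nat.card_le_card_of_injective f hf).trans ?_
  rw [Nat.card_prod, Nat.card_prod, Nat.card_prod, card_degreeLT']
  apply le_of_eq
  ring

/-- Suppose `char(F_q) ≠ 3` and fix `A ≥ 0`. There exists a constant `C > 0` depending
only on `q` and `A` such that for every integer `T ≥ 1` and every monic `r ∈ F_q[t]`
with `3·deg r ≤ T`, one has
`(|r|/q^T) · #{k ∈ S_A : |k| < q^T and r ∣ k} ≤ C · ρ(r)/|r|²`. -/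
theorem divisor_density_SA_bound (Fq : Type*) [Field Fq] [Fintype Fq]
    (hchar : ringChar Fq ≠ 3) (A : ℝ) (hA : 0 ≤ A) :
    ∃ C : ℝ, 0 < C ∧ ∀ T : ℕ, 1 ≤ T → ∀ r : Polynomial Fq, r.Monic →
      3 * r.natDegree ≤ T →
      ((Fintype.card Fq : ℝ) ^ r.natDegree / (Fintype.card Fq : ℝ) ^ T) *
          (Nat.card {k : Polynomial Fq //
            SA A k ∧ k.degree < (T : WithBot ℕ) ∧ r ∣ k} : ℝ) ≤
        C * (Nat.card {v : (Polynomial Fq ⧸ Ideal.span {r}) × (Polynomial Fq ⧸ Ideal.span {r}) ×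
            (Polynomial Fq ⧸ Ideal.span {r}) //
            v.1 ^ 3 + v.2.1 ^ 3 + v.2.2 ^ 3 = 0} : ℝ) /
          ((Fintype.card Fq : ℝ) ^ r.natDegree) ^ 2 := by
  have hq : (0 : ℝ) < (Fintype.card Fq : ℝ) := by exact_mod_cast Fintype.card_pos
  have hq1 : (1 : ℝ) ≤ (Fintype.card Fq : ℝ) := by exact_mod_cast Fintype.card_pos
  refine ⟨(Fintype.card Fq : ℝ) ^ (3 * (⌈A⌉₊ + 1)), by positivity, ?_⟩
  intro T _ r hr hT
  have hc := count_bound Fq A T r hr hT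
  generalize Nat.card {k : Polynomial Fq // SA A k ∧ k.degree < (T : WithBot ℕ) ∧ r ∣ k} = a at *
  generalize Nat.card {v : (Polynomial Fq ⧸ Ideal.span {r}) × (Polynomial Fq ⧸ Ideal.span {r}) ×
            (Polynomial Fq ⧸ Ideal.span {r}) //
            v.1 ^ 3 + v.2.1 ^ 3 + v.2.2 ^ 3 = 0} = b at *
  obtain ⟨e, he⟩ : ∃ e, T / 3 + ⌈A⌉₊ + 1 = r.natDegree + e := ⟨_, (Nat.add_sub_of_le (by omega)).symm⟩
  rw [he, Nat.add_sub_cancel_left] at hc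
  have hc' : (a : ℝ) ≤ b * ((Fintype.card Fq : ℝ) ^ e) ^ 3 := by exact_mod_cast hc
  generalize (Fintype.card Fq : ℝ) = q at *
  generalize r.natDegree = d at *
  have hpow : q ^ (3 * d + 3 * e) ≤ q ^ (T + 3 * (⌈A⌉₊ + 1)) :=
    pow_le_pow_right₀ hq1 (by omega)
  rw [div_mul_eq_mul_div, div_le_div_iff₀ (by positivity) (by positivity)]
  calc q ^ d * a * (q ^ d) ^ 2 ≤ q ^ d * (b * (q ^ e) ^ 3) * (q ^ d) ^ 2 := by gcongr
    _ = b * q ^ (3 * d + 3 * e) := by ring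
    _ ≤ b * q ^ (T + 3 * (⌈A⌉₊ + 1)) := by gcongr
    _ = _ := by ring
end

section
/- Suppose F_q is a finite field with gcd(q,3) = 1. There exist infinitely many positive integers d with the following property: for every monic irreducible ϖ ∈ F_q[t] of degree 2d, every multiplicative character χ of exact order 3 of the residue field O/ϖO (a field with q^{2d} elements), and every nontrivial additive character ψ of O/ϖO, one has Re(g(χ,ψ)³) ≤ −(9/10)·q^{3d}. -/
open Polynomial

namespace HD
set_option linter.style.haveILetI false
noncomputable section
set_option linter.unusedSectionVars false
open scoped Classical

variable {k : Type*} [Field k] [Fintype k]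

def lam (χ : MulChar k ℂ) (ψ : AddChar k ℂ) (f : k[X]) : ℂ :=
  χ ((-1) ^ f.natDegree * f.coeff 0) * ψ (-f.nextCoeff)

lemma lam_one (χ : MulChar k ℂ) (ψ : AddChar k ℂ) : lam χ ψ 1 = 1 := by
  simp [lam, nextCoeff]

lemma lam_mul (χ : MulChar k ℂ) (ψ : AddChar k ℂ) {f g : k[X]} (hf : f.Monic) (hg : g.Monic) :
    lam χ ψ (f * g) = lam χ ψ f * lam χ ψ g := by
  simp only [lam, hf.natDegree_mul hg, hf.nextCoeff_mul hg, mul_coeff_zero, pow_add, neg_add,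
    AddChar.map_add_eq_mul, map_mul]
  ring

lemma lam_pow (χ : MulChar k ℂ) (ψ : AddChar k ℂ) {f : k[X]} (hf : f.Monic) (n : ℕ) :
    lam χ ψ (f ^ n) = lam χ ψ f ^ n := by
  induction n with
  | zero => simp [lam_one]
  | succ n ih => rw [pow_succ, lam_mul _ _ (hf.pow n) hf, ih, pow_succ]

lemma finite_monic (n : ℕ) : {f : k[X] | f.Monic ∧ f.natDegree = n}.Finite := by
  have : Finite (degreeLT k n) := Finite.of_equiv _ (degreeLTEquiv k n).toEquiv.symm
  have h : Finite {f : k[X] // f.Monic ∧ f.natDegree = n} :=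
    Finite.of_equiv _ (monicEquivDegreeLT (R := k) n).symm
  exact Set.finite_coe_iff.mp h

def M (k : Type*) [Field k] [Fintype k] (n : ℕ) : Finset k[X] := (finite_monic (k := k) n).toFinset

@[simp] lemma mem_M {n : ℕ} {f : k[X]} : f ∈ M k n ↔ f.Monic ∧ f.natDegree = n := by
  simp [M]

def A (χ : MulChar k ℂ) (ψ : AddChar k ℂ) (n : ℕ) : ℂ := ∑ f ∈ M k n, lam χ ψ f

lemma A_zero (χ : MulChar k ℂ) (ψ : AddChar k ℂ) : A χ ψ 0 = 1 := by
  have : M k 0 = {1} := by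
    ext f
    simp only [mem_M, Finset.mem_singleton]
    constructor
    · rintro ⟨h, h0⟩; exact h.natDegree_eq_zero.mp h0
    · rintro rfl; simp
  rw [A, this, Finset.sum_singleton, lam_one]

lemma A_one (χ : MulChar k ℂ) (ψ : AddChar k ℂ) : A χ ψ 1 = gaussSum χ ψ := by
  unfold A gaussSum
  symm
  refine Finset.sum_bij (fun a _ => X - C a) ?_ ?_ ?_ ?_
  · intro a _; simp [monic_X_sub_C]
  · intro a _ b _ h; simpa using h
  · intro f hf
    rw [mem_M] at hf
    refine ⟨-f.coeff 0, Finset.mem_univ _, ?_⟩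
    rw [hf.1.eq_X_add_C hf.2]; simp
  · intro a _
    simp [lam, nextCoeff_X_sub_C]

lemma A_ge_two (χ : MulChar k ℂ) {ψ : AddChar k ℂ} (hψ : ψ ≠ 1) {n : ℕ} (hn : 2 ≤ n) :
    A χ ψ n = 0 := by
  obtain ⟨b, hb⟩ := AddChar.ne_one_iff.mp hψ
  have key : A χ ψ n = ψ b * A χ ψ n := by
    unfold A
    rw [Finset.mul_sum]
    have hd : ∀ (c : k) (f : k[X]), f.Monic → f.natDegree = n →
        (f + C c * X ^ (n-1)).Monic ∧ (f + C c * X ^ (n-1)).natDegree = n := by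
      intro c f hf hfn
      have hlt : (C c * X ^ (n-1)).degree < f.degree := by
        refine lt_of_le_of_lt (degree_C_mul_X_pow_le _ _) ?_
        rw [degree_eq_natDegree hf.ne_zero, hfn]
        exact_mod_cast (by omega : n - 1 < n)
      refine ⟨hf.add_of_left hlt, ?_⟩
      rw [natDegree_add_eq_left_of_degree_lt hlt, hfn]
    refine Finset.sum_bij (fun f _ => f + C b * X ^ (n-1)) ?_ ?_ ?_ ?_
    · intro f hf
      rw [mem_M] at hf ⊢
      exact hd b f hf.1 hf.2
    · intro f _ g _ h; simpa using h
    · intro f hf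
      rw [mem_M] at hf
      refine ⟨f + C (-b) * X ^ (n-1), ?_, ?_⟩
      · rw [mem_M]; exact hd (-b) f hf.1 hf.2
      · simp
    · intro f hf
      rw [mem_M] at hf
      have h1 := hd b f hf.1 hf.2
      have hc : (f + C b * X ^ (n-1)).nextCoeff = f.nextCoeff + b := by
        rw [nextCoeff_of_natDegree_pos (by omega), nextCoeff_of_natDegree_pos (by omega), h1.2, hf.2]
        simp
      have h0 : (f + C b * X ^ (n-1)).coeff 0 = f.coeff 0 := by
        rw [coeff_add, coeff_C_mul, coeff_X_pow, if_neg (by omega), mul_zero, add_zero]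
      simp only [lam, hc, h0, h1.2, hf.2]
      rw [show -f.nextCoeff = b + -(f.nextCoeff + b) by ring, AddChar.map_add_eq_mul]
      ring
  have : (1 - ψ b) * A χ ψ n = 0 := by linear_combination key
  rcases mul_eq_zero.mp this with h | h
  · exact absurd (by linear_combination -h) hb
  · exact h

/-- monic irreducibles of degree at most `n` -/
def I (k : Type*) [Field k] [Fintype k] (n : ℕ) : Finset k[X] :=
  ((Finset.range (n+1)).biUnion (M k)).filter Irreducible

@[simp] lemma mem_I {n : ℕ} {f : k[X]} :
    f ∈ I k n ↔ f.Monic ∧ f.natDegree ≤ n ∧ Irreducible f := by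
  simp [I, Nat.lt_succ_iff]; tauto

def S (χ : MulChar k ℂ) (ψ : AddChar k ℂ) (n : ℕ) : ℂ :=
  ∑ P ∈ I k n, ∑ i ∈ Finset.Icc 1 n,
    if i * P.natDegree = n then (P.natDegree : ℂ) * lam χ ψ P ^ i else 0

lemma S_eq (χ : MulChar k ℂ) (ψ : AddChar k ℂ) {n N : ℕ} (hn : 1 ≤ n) (h : n ≤ N) : S χ ψ n =
    ∑ P ∈ I k N, ∑ i ∈ Finset.Icc 1 N,
    if i * P.natDegree = n then (P.natDegree : ℂ) * lam χ ψ P ^ i else 0 := by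
  unfold S
  have h1 : ∀ P ∈ I k N, (∑ i ∈ Finset.Icc 1 n,
      if i * P.natDegree = n then (P.natDegree : ℂ) * lam χ ψ P ^ i else 0) =
      ∑ i ∈ Finset.Icc 1 N,
      if i * P.natDegree = n then (P.natDegree : ℂ) * lam χ ψ P ^ i else 0 := by
    intro P hP
    rw [mem_I] at hP
    apply Finset.sum_subset
    · exact Finset.Icc_subset_Icc_right h
    · intro i hi hi'
      rw [if_neg]
      intro hh
      apply hi'
      have := hP.2.2.natDegree_pos
      simp only [Finset.mem_Icc] at hi ⊢
      refine ⟨hi.1, ?_⟩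
      rw [← hh]; exact Nat.le_mul_of_pos_right _ this
  rw [← Finset.sum_congr rfl h1]
  apply Finset.sum_subset
  · intro P hP
    rw [mem_I] at hP ⊢
    exact ⟨hP.1, hP.2.1.trans h, hP.2.2⟩
  · intro P hP hP'
    rw [mem_I] at hP hP'
    apply Finset.sum_eq_zero
    intro i hi
    rw [if_neg]
    intro hh
    apply hP'
    refine ⟨hP.1, ?_, hP.2.2⟩
    simp only [Finset.mem_Icc] at hi
    rw [← hh]; exact Nat.le_mul_of_pos_left _ hi.1

lemma natDegree_eq_sum {n : ℕ} {f : k[X]} (hf : f.Monic) (hn : f.natDegree = n) :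
    n = ∑ P ∈ I k n, ∑ i ∈ Finset.Icc 1 n, if P ^ i ∣ f then P.natDegree else 0 := by
  have hprod : (UniqueFactorizationMonoid.normalizedFactors f).prod = f := by
    rw [UniqueFactorizationMonoid.prod_normalizedFactors_eq hf.ne_zero, hf.normalize_eq_self]
  have hmon : ∀ g ∈ UniqueFactorizationMonoid.normalizedFactors f, g.Monic ∧ Irreducible g ∧
      g.natDegree ≤ n := by
    intro g hg
    have hirr := UniqueFactorizationMonoid.irreducible_of_normalized_factor g hg
    have hno := UniqueFactorizationMonoid.normalize_normalized_factor g hg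
    refine ⟨?_, hirr, ?_⟩
    · rw [← hno]; exact monic_normalize hirr.ne_zero
    · rw [← hn]; exact natDegree_le_of_dvd
        (UniqueFactorizationMonoid.dvd_of_mem_normalizedFactors hg) hf.ne_zero
  have h1 : n = ((UniqueFactorizationMonoid.normalizedFactors f).map natDegree).sum := by
    rw [← natDegree_multiset_prod_of_monic _ (fun g hg => (hmon g hg).1), hprod, hn]
  have h2 : ((UniqueFactorizationMonoid.normalizedFactors f).map natDegree).sum =
      ∑ P ∈ I k n, (UniqueFactorizationMonoid.normalizedFactors f).count P * P.natDegree := by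
    rw [Finset.sum_multiset_map_count]
    simp only [smul_eq_mul]
    apply Finset.sum_subset
    · intro P hP
      rw [Multiset.mem_toFinset] at hP
      rw [mem_I]
      exact ⟨(hmon P hP).1, (hmon P hP).2.2, (hmon P hP).2.1⟩
    · intro P _ hP
      rw [Multiset.mem_toFinset] at hP
      simp [Multiset.count_eq_zero_of_notMem hP]
  conv_lhs => rw [h1, h2]
  apply Finset.sum_congr rfl
  intro P hP
  rw [mem_I] at hP
  have hiff : ∀ i, P ^ i ∣ f ↔ i ≤ (UniqueFactorizationMonoid.normalizedFactors f).count P := by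
    intro i
    rw [pow_dvd_iff_le_emultiplicity,
      UniqueFactorizationMonoid.emultiplicity_eq_count_normalizedFactors hP.2.2 hf.ne_zero,
      hP.1.normalize_eq_self]
    exact_mod_cast Iff.rfl
  have hle : (UniqueFactorizationMonoid.normalizedFactors f).count P ≤ n := by
    have := natDegree_le_of_dvd ((hiff _).2 le_rfl) hf.ne_zero
    rw [natDegree_pow, hn] at this
    exact le_trans (Nat.le_mul_of_pos_right _ hP.2.2.natDegree_pos) this
  simp only [hiff]
  rw [← Finset.sum_filter, Finset.sum_const, smul_eq_mul]
  congr 1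
  have : Finset.filter (fun i => i ≤ (UniqueFactorizationMonoid.normalizedFactors f).count P)
      (Finset.Icc 1 n) = Finset.Icc 1 ((UniqueFactorizationMonoid.normalizedFactors f).count P) := by
    ext i; simp only [Finset.mem_filter, Finset.mem_Icc]; omega
  rw [this]; simp

lemma sum_dvd (χ : MulChar k ℂ) (ψ : AddChar k ℂ) {n : ℕ} {g : k[X]} (hg : g.Monic) :
    (∑ f ∈ M k n, if g ∣ f then lam χ ψ f else 0) =
      if g.natDegree ≤ n then lam χ ψ g * A χ ψ (n - g.natDegree) else 0 := by
  rw [← Finset.sum_filter]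
  split_ifs with h
  · unfold A
    rw [Finset.mul_sum]
    symm
    refine Finset.sum_bij (fun f _ => g * f) ?_ ?_ ?_ ?_
    · intro f hf
      rw [mem_M] at hf
      rw [Finset.mem_filter, mem_M, hg.natDegree_mul hf.1]
      exact ⟨⟨hg.mul hf.1, by omega⟩, dvd_mul_right _ _⟩
    · intro f _ f' _ hh
      exact mul_left_cancel₀ hg.ne_zero hh
    · intro f hf
      rw [Finset.mem_filter, mem_M] at hf
      obtain ⟨⟨hfm, hfn⟩, r, rfl⟩ := hf
      have hr := hg.of_mul_monic_left hfm
      refine ⟨r, ?_, rfl⟩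
      rw [mem_M]
      refine ⟨hr, ?_⟩
      rw [hg.natDegree_mul hr] at hfn; omega
    · intro f hf
      rw [mem_M] at hf
      rw [lam_mul _ _ hg hf.1]
  · apply Finset.sum_eq_zero
    intro f hf
    rw [Finset.mem_filter, mem_M] at hf
    exact absurd (hf.1.2 ▸ natDegree_le_of_dvd hf.2 hf.1.1.ne_zero) h

lemma newton (χ : MulChar k ℂ) (ψ : AddChar k ℂ) (n : ℕ) :
    (n : ℂ) * A χ ψ n = ∑ j ∈ Finset.Icc 1 n, S χ ψ j * A χ ψ (n - j) := by
  have lhs : (n : ℂ) * A χ ψ n = ∑ P ∈ I k n, ∑ i ∈ Finset.Icc 1 n, (P.natDegree : ℂ) *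
      (if i * P.natDegree ≤ n then lam χ ψ P ^ i * A χ ψ (n - i * P.natDegree) else 0) := by
    unfold A
    rw [Finset.mul_sum]
    have : ∀ f ∈ M k n, (n : ℂ) * lam χ ψ f = ∑ P ∈ I k n, ∑ i ∈ Finset.Icc 1 n,
        (P.natDegree : ℂ) * if P ^ i ∣ f then lam χ ψ f else 0 := by
      intro f hf
      rw [mem_M] at hf
      have h := congrArg (Nat.cast (R := ℂ)) (natDegree_eq_sum hf.1 hf.2)
      push_cast at h
      conv_lhs => rw [h]
      rw [Finset.sum_mul]
      refine Finset.sum_congr rfl fun P _ => ?_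
      rw [Finset.sum_mul]
      refine Finset.sum_congr rfl fun i _ => ?_
      split_ifs <;> simp
    rw [Finset.sum_congr rfl this, Finset.sum_comm]
    refine Finset.sum_congr rfl fun P hP => ?_
    rw [mem_I] at hP
    rw [Finset.sum_comm]
    refine Finset.sum_congr rfl fun i _ => ?_
    rw [← Finset.mul_sum, sum_dvd χ ψ (hP.1.pow i), natDegree_pow, lam_pow _ _ hP.1]
    rfl
  rw [lhs]
  have rhs : ∀ j ∈ Finset.Icc 1 n, S χ ψ j * A χ ψ (n - j) =
      ∑ P ∈ I k n, ∑ i ∈ Finset.Icc 1 n,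
      if i * P.natDegree = j then (P.natDegree : ℂ) * lam χ ψ P ^ i * A χ ψ (n - j) else 0 := by
    intro j hj
    rw [Finset.mem_Icc] at hj
    rw [S_eq χ ψ hj.1 hj.2, Finset.sum_mul]
    refine Finset.sum_congr rfl fun P _ => ?_
    rw [Finset.sum_mul]
    refine Finset.sum_congr rfl fun i _ => ?_
    split_ifs <;> simp
  rw [Finset.sum_congr rfl rhs,
    Finset.sum_comm (s := Finset.Icc 1 n) (t := I k n)]
  refine Finset.sum_congr rfl fun P hP => ?_
  rw [mem_I] at hP
  conv_rhs => rw [Finset.sum_comm]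
  refine Finset.sum_congr rfl fun i hi => ?_
  rw [Finset.sum_ite_eq]
  rw [Finset.mem_Icc] at hi
  have hpos : 1 ≤ i * P.natDegree := Nat.mul_pos hi.1 hP.2.2.natDegree_pos
  by_cases h : i * P.natDegree ≤ n
  · rw [if_pos h, if_pos (Finset.mem_Icc.2 ⟨hpos, h⟩)]; ring
  · rw [if_neg h, if_neg (fun h' => h (Finset.mem_Icc.1 h').2)]; ring

lemma S_formula (χ : MulChar k ℂ) {ψ : AddChar k ℂ} (hψ : ψ ≠ 1) (n : ℕ) :
    S χ ψ (n + 1) = -(-gaussSum χ ψ) ^ (n + 1) := by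
  induction n with
  | zero =>
    have := newton χ ψ 1
    simp [A_one, A_zero] at this
    simp [← this]
  | succ n ih =>
    have := newton χ ψ (n + 2)
    rw [A_ge_two χ hψ (by omega), Finset.sum_Icc_succ_top (by omega),
      Finset.sum_Icc_succ_top (by omega), Finset.sum_eq_zero] at this
    · simp [A_zero, A_one, show n + 2 - (n + 1) = 1 by omega] at this
      rw [pow_succ, ← neg_mul, ← ih]
      linear_combination -this
    · intro j hj
      rw [Finset.mem_Icc] at hj
      rw [A_ge_two χ hψ (by omega), mul_zero]

variable {K : Type*} [Field K] [Fintype K] [Algebra k K]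

lemma finrank_mul (x : K) :
    Module.finrank (IntermediateField.adjoin k {x}) K * (minpoly k x).natDegree =
      Module.finrank k K := by
  rw [← IntermediateField.adjoin.finrank (Algebra.IsIntegral.isIntegral (R := k) x), mul_comm]
  exact Module.finrank_mul_finrank _ _ _

lemma lam_minpoly (χ : MulChar k ℂ) (ψ : AddChar k ℂ) (x : K) :
    χ (Algebra.norm k x) * ψ (Algebra.trace k K x) =
      lam χ ψ (minpoly k x) ^ Module.finrank (IntermediateField.adjoin k {x}) K := by
  have hx : IsIntegral k x := Algebra.IsIntegral.isIntegral x
  rw [trace_eq_finrank_mul_minpoly_nextCoeff, Algebra.norm_eq_norm_adjoin]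
  have := Algebra.PowerBasis.norm_gen_eq_coeff_zero_minpoly (IntermediateField.adjoin.powerBasis hx)
  rw [IntermediateField.adjoin.powerBasis_gen, IntermediateField.adjoin.powerBasis_dim,
    IntermediateField.minpoly_gen] at this
  rw [this, lam, mul_pow (χ _), map_pow, ← AddChar.map_nsmul_eq_pow, nsmul_eq_mul]

lemma card_fiber {P : k[X]} (hP : P.Monic) (hi : Irreducible P)
    (hd : P.natDegree ∣ Module.finrank k K) :
    (Finset.univ.filter (fun x : K => minpoly k x = P)).card = P.natDegree := by
  have h1 : P ∣ X ^ (Nat.card K) - X := by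
    rw [Module.natCard_eq_pow_finrank (K := k)]
    exact hi.natDegree_dvd_iff_dvd_X_pow_card_pow_sub_X.mp hd
  have hne : (X ^ (Nat.card K) - X : K[X]) ≠ 0 :=
    FiniteField.X_pow_card_sub_X_ne_zero K Finite.one_lt_card
  have hsp : (P.map (algebraMap k K)).Splits := by
    refine Splits.of_dvd (splits_X_pow_nat_card_sub_X (K := K)) hne ?_
    simpa using Polynomial.map_dvd (algebraMap k K) h1
  have hsep : P.Separable := PerfectField.separable_of_irreducible hi
  have : (Finset.univ.filter (fun x : K => minpoly k x = P)) = (P.rootSet K).toFinset := by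
    ext x
    simp only [Finset.mem_filter, Finset.mem_univ, true_and, Set.mem_toFinset,
      mem_rootSet]
    constructor
    · rintro rfl; exact ⟨hi.ne_zero, minpoly.aeval _ _⟩
    · rintro ⟨_, h⟩; exact (minpoly.eq_of_irreducible_of_monic hi h hP).symm
  rw [this, Set.toFinset_card]
  exact card_rootSet_eq_natDegree hsep hsp

lemma sum_eq_S (χ : MulChar k ℂ) (ψ : AddChar k ℂ) :
    ∑ x : K, χ (Algebra.norm k x) * ψ (Algebra.trace k K x) = S χ ψ (Module.finrank k K) := by
  have hpos : 0 < Module.finrank k K := Module.finrank_pos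
  rw [← Finset.sum_fiberwise_of_maps_to (g := fun x : K => minpoly k x)
    (t := I k (Module.finrank k K))]
  · unfold S
    refine Finset.sum_congr rfl fun P hP => ?_
    rw [mem_I] at hP
    have hdp := hP.2.2.natDegree_pos
    by_cases hd : P.natDegree ∣ Module.finrank k K
    · obtain ⟨c, hc⟩ := hd
      rw [Finset.sum_congr rfl (g := fun _ => lam χ ψ P ^ c), Finset.sum_const,
        card_fiber hP.1 hP.2.2 ⟨c, hc⟩, Finset.sum_eq_single c]
      · rw [if_pos (by rw [hc, mul_comm]), nsmul_eq_mul]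
      · intro b _ hb
        rw [if_neg]
        intro h
        rw [hc, mul_comm] at h
        exact hb (Nat.eq_of_mul_eq_mul_left hdp h)
      · intro h
        exfalso; apply h
        rw [Finset.mem_Icc]
        constructor
        · rcases Nat.eq_zero_or_pos c with rfl | h
          · omega
          · exact h
        · rw [hc]; exact Nat.le_mul_of_pos_left _ hdp
      · intro x hx
        have hx' : minpoly k x = P := by simpa using hx
        rw [lam_minpoly, hx']
        have := finrank_mul (k := k) x
        rw [hx', hc, mul_comm] at this
        rw [Nat.eq_of_mul_eq_mul_left hdp this]
    · rw [Finset.sum_eq_zero, Finset.sum_eq_zero]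
      · intro i _
        rw [if_neg]
        intro h; exact hd ⟨i, by rw [← h, mul_comm]⟩
      · intro x hx
        have hx' : minpoly k x = P := by simpa using hx
        exact absurd ⟨_, by rw [← hx', ← finrank_mul (k := k) x, mul_comm]⟩ hd
  · intro x _
    have hx : IsIntegral k x := Algebra.IsIntegral.isIntegral x
    rw [mem_I]
    exact ⟨minpoly.monic hx, minpoly.natDegree_le x, minpoly.irreducible hx⟩

/-- Hasse-Davenport -/
lemma hasse_davenport (χ : MulChar k ℂ) {ψ : AddChar k ℂ} (hψ : ψ ≠ 1) :
    ∑ x : K, χ (Algebra.norm k x) * ψ (Algebra.trace k K x) =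
      -(-gaussSum χ ψ) ^ (Module.finrank k K) := by
  rw [sum_eq_S]
  obtain ⟨n, hn⟩ := Nat.exists_eq_succ_of_ne_zero (Module.finrank_pos (R := k) (M := K)).ne'
  rw [hn]; exact S_formula χ hψ n

/-- every cubic character of `K` is a lift -/
lemma exists_lift (h3 : 3 ∣ Fintype.card k - 1) (χK : MulChar K ℂ) (hχ : orderOf χK = 3) :
    ∃ χ : MulChar k ℂ, χ ≠ 1 ∧ ∀ x : K, χK x = χ (Algebra.norm k x) := by
  obtain ⟨χ, hχ3⟩ := MulChar.exists_mulChar_orderOf k h3 (Complex.isPrimitiveRoot_exp 3 (by norm_num))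
  obtain ⟨g, hg⟩ := IsCyclic.exists_generator (α := Kˣ)
  have hp3 : χ ^ 3 = 1 := hχ3 ▸ pow_orderOf_eq_one χ
  have hK3 : χK ^ 3 = 1 := hχ ▸ pow_orderOf_eq_one χK
  let nm : Kˣ →* kˣ := Units.map (Algebra.norm k (S := K))
  have hnm : Function.Surjective nm := FiniteField.unitsMap_norm_surjective k K
  have hz3 : (χ (nm g)) ^ 3 = 1 := by
    rw [← MulChar.pow_apply_coe, hp3, MulChar.one_apply_coe]
  have hw3 : (χK g) ^ 3 = 1 := by
    rw [← MulChar.pow_apply_coe, hK3, MulChar.one_apply_coe]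
  have hz1 : χ (nm g) ≠ 1 := by
    intro h1
    have : χ = 1 := by
      rw [MulChar.eq_one_iff]
      intro a
      obtain ⟨x, rfl⟩ := hnm a
      obtain ⟨n, rfl⟩ := hg x
      have : χ.toUnitHom (nm g) = 1 := by ext; simpa using h1
      have h2 : χ.toUnitHom (nm (g ^ n)) = 1 := by rw [map_zpow, map_zpow, this, one_zpow]
      rw [← MulChar.coe_toUnitHom]
      simp only [h2, Units.val_one]
    rw [this, orderOf_one] at hχ3
    omega
  have hprim : IsPrimitiveRoot (χ (nm g)) 3 := by
    rw [IsPrimitiveRoot.iff_orderOf]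
    haveI : Fact (Nat.Prime 3) := ⟨Nat.prime_three⟩
    exact orderOf_eq_prime hz3 hz1
  obtain ⟨j, _, hj⟩ := hprim.eq_pow_of_pow_eq_one hw3
  have hunit : ∀ x : Kˣ, χK x = (χ ^ j) (nm x) := by
    intro x
    obtain ⟨n, rfl⟩ := hg x
    have h0 : χK.toUnitHom g = (χ ^ j).toUnitHom (nm g) := by
      ext
      rw [MulChar.coe_toUnitHom, MulChar.coe_toUnitHom, MulChar.pow_apply_coe, hj]
    have h2 : χK.toUnitHom (g ^ n) = (χ ^ j).toUnitHom (nm (g ^ n)) := by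
      rw [map_zpow, map_zpow, map_zpow, h0]
    rw [← MulChar.coe_toUnitHom, ← MulChar.coe_toUnitHom]
    exact congrArg Units.val h2
  refine ⟨χ ^ j, ?_, ?_⟩
  · intro h
    have : χK = 1 := by
      rw [MulChar.eq_one_iff]
      intro a
      rw [hunit, h, MulChar.one_apply_coe]
    rw [this, orderOf_one] at hχ
    omega
  · intro x
    rcases eq_or_ne x 0 with rfl | hx
    · rw [MulChar.map_zero, Algebra.norm_zero, MulChar.map_zero]
    · exact hunit (Units.mk0 x hx)

lemma gauss_cube_indep (χ : MulChar K ℂ) (hχ : orderOf χ = 3) {ψ φ : AddChar K ℂ} (hψ : ψ ≠ 1)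
    (hφ : φ ≠ 1) : gaussSum χ ψ ^ 3 = gaussSum χ φ ^ 3 := by
  have hK3 : χ ^ 3 = 1 := hχ ▸ pow_orderOf_eq_one χ
  have hinj := AddChar.to_mulShift_inj_of_isPrimitive (AddChar.IsPrimitive.of_ne_one hφ)
  have hbij : Function.Bijective φ.mulShift :=
    (Fintype.bijective_iff_injective_and_card _).2 ⟨hinj, AddChar.card_eq.symm⟩
  obtain ⟨a, rfl⟩ := hbij.2 ψ
  have ha : a ≠ 0 := by
    rintro rfl
    exact hψ (AddChar.mulShift_zero φ)
  have := gaussSum_mulShift χ φ (Units.mk0 a ha)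
  rw [← this, mul_pow, ← MulChar.pow_apply_coe, hK3, MulChar.one_apply_coe, one_mul]
  rfl

lemma gauss_cube (h3 : 3 ∣ Fintype.card k - 1) (χK : MulChar K ℂ) (hχ : orderOf χK = 3)
    {ψK : AddChar K ℂ} (hψK : ψK ≠ 1) {ψ : AddChar k ℂ} (hψ : ψ ≠ 1) :
    ∃ χ : MulChar k ℂ, χ ≠ 1 ∧
      gaussSum χK ψK ^ 3 = -((-gaussSum χ ψ) ^ 3) ^ (Module.finrank k K) := by
  obtain ⟨χ, h1, hl⟩ := exists_lift (k := k) h3 χK hχ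
  refine ⟨χ, h1, ?_⟩
  let φ : AddChar K ℂ := ψ.compAddMonoidHom (Algebra.trace k K).toAddMonoidHom
  have hφ : φ ≠ 1 := by
    obtain ⟨b, hb⟩ := AddChar.ne_one_iff.mp hψ
    obtain ⟨x, rfl⟩ := Algebra.trace_surjective k K b
    exact AddChar.ne_one_iff.mpr ⟨x, hb⟩
  have : gaussSum χK φ = -(-gaussSum χ ψ) ^ (Module.finrank k K) := by
    rw [← hasse_davenport (K := K) χ hψ, gaussSum]
    refine Finset.sum_congr rfl fun x _ => ?_
    rw [hl]; rfl
  rw [gauss_cube_indep χK hχ hψK hφ, this, ← pow_mul, mul_comm 3, pow_mul]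
  ring

lemma norm_gauss {χ : MulChar k ℂ} (hχ : χ ≠ 1) {ψ : AddChar k ℂ} (hψ : ψ ≠ 1) {q : ℕ}
    (hq : Fintype.card k = q ^ 2) : ‖gaussSum χ ψ‖ = q := by
  have h := gaussSum_mul_gaussSum_eq_card hχ (AddChar.IsPrimitive.of_ne_one hψ)
  rw [← star_gaussSum_eq, hq] at h
  have h2 := congrArg norm h
  rw [norm_mul, norm_star] at h2
  simp at h2
  have h0 := norm_nonneg (gaussSum χ ψ)
  have hq0 : (0:ℝ) ≤ q := Nat.cast_nonneg q
  nlinarith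

lemma exists_circle {q : ℕ} (hq0 : 0 < q) (hq : Fintype.card k = q ^ 2) {ψ : AddChar k ℂ}
    (hψ : ψ ≠ 1) : ∃ u : MulChar k ℂ → Circle, ∀ χ, χ ≠ 1 →
      (-gaussSum χ ψ) ^ 3 = (q : ℂ) ^ 3 * (u χ : ℂ) := by
  have : ∀ χ : MulChar k ℂ, ∃ c : Circle, χ ≠ 1 → (-gaussSum χ ψ) ^ 3 = (q : ℂ) ^ 3 * (c : ℂ) := by
    intro χ
    by_cases h : χ = 1
    · exact ⟨1, fun h' => absurd h h'⟩
    · have hq' : (q : ℂ) ≠ 0 := by exact_mod_cast hq0.ne'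
      have hq'' : (q : ℝ) ≠ 0 := by exact_mod_cast hq0.ne'
      refine ⟨⟨(-gaussSum χ ψ) ^ 3 / (q : ℂ) ^ 3, ?_⟩, fun _ => ?_⟩
      · change _ ∈ Metric.sphere (0 : ℂ) 1
        rw [mem_sphere_zero_iff_norm, norm_div, norm_pow, norm_neg, norm_gauss h hψ hq]
        simp [hq'']
      · change _ = _ * ((-gaussSum χ ψ) ^ 3 / (q : ℂ) ^ 3)
        field_simp
  choose u hu using this
  exact ⟨u, hu⟩

lemma infinite_return {ι : Type*} [Finite ι] (u : ι → Circle) :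
    {d : ℕ | 0 < d ∧ ∀ i, 9 / 10 ≤ ((u i : ℂ) ^ d).re}.Infinite := by
  have h := mapClusterPt_one_atTop_pow u
  have hU : {v : ι → Circle | ∀ i, 9 / 10 < ((v i : ℂ)).re} ∈ nhds (1 : ι → Circle) := by
    apply IsOpen.mem_nhds
    · rw [Set.ofPred_forall]
      refine isOpen_iInter_of_finite fun i => ?_
      refine isOpen_lt continuous_const ?_
      exact Complex.continuous_re.comp (continuous_subtype_val.comp (continuous_apply i))
    · intro i; norm_num
  have hf := (h.frequently hU).and_eventually (Filter.eventually_gt_atTop 0)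
  refine (Nat.frequently_atTop_iff_infinite.mp hf).mono ?_
  rintro d ⟨hd, h0⟩
  refine ⟨h0, fun i => ?_⟩
  have := hd i
  simp only [Pi.pow_apply, Circle.coe_pow] at this
  exact this.le

end
end HD

/-- Suppose `F_q` is a finite field with `gcd(q,3) = 1`. There exist infinitely many
positive integers `d` such that: for every monic irreducible `ϖ ∈ F_q[t]` of degree `2d`,
every multiplicative character `χ` of exact order `3` of the residue field `O/ϖO`, and
every nontrivial additive character `ψ` of `O/ϖO`, one has
`Re(g(χ,ψ)³) ≤ −(9/10)·q^{3d}`. -/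
theorem infinitely_many_d_gauss_sum_negative (Fq : Type*) [Field Fq] [Fintype Fq]
    (hq : Nat.gcd (Fintype.card Fq) 3 = 1) :
    {d : ℕ | 0 < d ∧ ∀ ϖ : Polynomial Fq, ϖ.Monic → Irreducible ϖ → ϖ.natDegree = 2 * d →
      ∀ [Fintype (Polynomial Fq ⧸ Ideal.span {ϖ})],
      ∀ χ : MulChar (Polynomial Fq ⧸ Ideal.span {ϖ}) ℂ, orderOf χ = 3 →
      ∀ ψ : AddChar (Polynomial Fq ⧸ Ideal.span {ϖ}) ℂ, ψ ≠ 1 →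
        (gaussSum χ ψ ^ 3).re ≤ -(9 / 10) * (Fintype.card Fq : ℝ) ^ (3 * d)}.Infinite := by
  classical
  obtain ⟨p, hp⟩ := CharP.exists Fq
  haveI : Fact (Nat.Prime p) := ⟨CharP.char_is_prime Fq p⟩
  let k := FiniteField.Extension Fq p 2
  letI : Fintype k := Fintype.ofFinite k
  have hcard : Fintype.card k = Fintype.card Fq ^ 2 := by
    rw [← Nat.card_eq_fintype_card, ← Nat.card_eq_fintype_card]
    exact FiniteField.natCard_extension Fq p 2
  have h3 : 3 ∣ Fintype.card k - 1 := by
    rw [hcard]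
    generalize Fintype.card Fq = q at hq
    have h : q % 3 = 1 ∨ q % 3 = 2 := by
      have : q % 3 ≠ 0 := fun h => by
        rw [Nat.gcd_eq_right (Nat.dvd_of_mod_eq_zero h)] at hq; omega
      omega
    have h' : q ^ 2 % 3 = 1 := by
      rcases h with h | h <;> simp [Nat.pow_mod, h]
    omega
  obtain ⟨ψ₀, hψ₀⟩ : ∃ ψ : AddChar k ℂ, ψ ≠ 1 := by
    have : 1 < Fintype.card (AddChar k ℂ) := by
      rw [AddChar.card_eq]; exact Fintype.one_lt_card
    haveI := Fintype.one_lt_card_iff_nontrivial.mp this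
    exact exists_ne 1
  obtain ⟨u, hu⟩ := HD.exists_circle Fintype.card_pos hcard hψ₀
  haveI : Finite (MulChar k ℂ) := inferInstance
  refine (HD.infinite_return u).mono ?_
  rintro d ⟨hd0, hd⟩
  refine ⟨hd0, ?_⟩
  intro ϖ hm hi hdeg _ χ hχ ψ hψ
  haveI : (Ideal.span {ϖ}).IsMaximal := PrincipalIdealRing.isMaximal_of_irreducible hi
  letI : Field (Polynomial Fq ⧸ Ideal.span {ϖ}) := Ideal.Quotient.field _
  have hfr : Module.finrank Fq (Polynomial Fq ⧸ Ideal.span {ϖ}) = 2 * d := by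
    rw [← hdeg]; exact finrank_quotient_span_eq_natDegree
  have hk2 : Module.finrank Fq k = 2 := FiniteField.finrank_extension Fq p 2
  obtain ⟨e⟩ : Nonempty (k →ₐ[Fq] (Polynomial Fq ⧸ Ideal.span {ϖ})) :=
    FiniteField.nonempty_algHom_of_finrank_dvd (by rw [hfr, hk2]; exact dvd_mul_right _ _)
  letI : Algebra k (Polynomial Fq ⧸ Ideal.span {ϖ}) := e.toRingHom.toAlgebra
  haveI : IsScalarTower Fq k (Polynomial Fq ⧸ Ideal.span {ϖ}) :=
    IsScalarTower.of_algebraMap_eq' e.comp_algebraMap.symm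
  have hfk : Module.finrank k (Polynomial Fq ⧸ Ideal.span {ϖ}) = d := by
    have := Module.finrank_mul_finrank Fq k (Polynomial Fq ⧸ Ideal.span {ϖ})
    rw [hfr, hk2] at this
    omega
  obtain ⟨χ₀, hχ₀, hg⟩ := HD.gauss_cube (k := k) h3 χ hχ hψ hψ₀
  rw [hg, hu χ₀ hχ₀, hfk, mul_pow, ← pow_mul]
  have h1 := hd χ₀
  have h2 : ((Fintype.card Fq : ℂ) ^ (3 * d) * (u χ₀ : ℂ) ^ d).re =
      (Fintype.card Fq : ℝ) ^ (3 * d) * ((u χ₀ : ℂ) ^ d).re := by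
    rw [← Complex.re_ofReal_mul]; push_cast; rfl
  rw [Complex.neg_re, h2]
  have h3 : (0:ℝ) ≤ (Fintype.card Fq : ℝ) ^ (3 * d) := by positivity
  nlinarith
end

section
/- Let F be a finite field with |F| ≡ 1 (mod 3), let χ be a multiplicative character of F of exact order 3, and let ψ be a nontrivial additive character of F. Then c := 2·Re(g(χ,ψ)³)/|F| is a rational integer satisfying |c| ≤ 2·|F|^{1/2}, and #{(x,y,z) ∈ F³ : x³ + y³ + z³ = 0} = |F|² + c·(|F| − 1). -/
open Finset

section helpers
variable {F : Type*} [Field F] [Fintype F]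

lemma chi_cube_aux {χ : MulChar F ℂ} (hχ : orderOf χ = 3) {y : F} (hy : y ≠ 0) :
    χ y ^ 3 = 1 := by
  have h : χ ^ 3 = 1 := by rw [← hχ]; exact pow_orderOf_eq_one χ
  have h2 : (χ ^ 3) y = χ y ^ 3 := MulChar.pow_apply' χ (by norm_num) y
  rw [← h2, h, MulChar.one_apply (isUnit_iff_ne_zero.mpr hy)]

lemma chi_neg_one_aux {χ : MulChar F ℂ} (hχ : orderOf χ = 3) : χ (-1) = 1 := by
  have h := chi_cube_aux hχ (y := (-1 : F)) (by simp)
  rw [← map_pow] at h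
  have : (-1 : F) ^ 3 = -1 := by ring
  rwa [this] at h

lemma exists_cube_of_chi_eq_one {χ : MulChar F ℂ} (hχ : orderOf χ = 3) {y : F} (hy : y ≠ 0)
    (h : χ y = 1) : ∃ a : F, a ^ 3 = y := by
  obtain ⟨u, hu⟩ := IsCyclic.exists_generator (α := Fˣ)
  have hu1 : χ u ≠ 1 := by
    intro h1
    have : χ = 1 := by
      refine MulChar.ext fun v => ?_
      obtain ⟨k, hk⟩ := (Submonoid.mem_powers_iff _ _).1 (mem_powers_iff_mem_zpowers.2 (hu v))
      rw [← hk, Units.val_pow_eq_pow_val, map_pow, h1, one_pow, ← Units.val_pow_eq_pow_val,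
        MulChar.one_apply_coe]
    rw [this, orderOf_one] at hχ
    norm_num at hχ
  have hu3 := chi_cube_aux hχ u.ne_zero
  have hord : orderOf (χ u) = 3 := orderOf_eq_prime hu3 hu1
  obtain ⟨k, hk⟩ := (Submonoid.mem_powers_iff _ _).1
    (mem_powers_iff_mem_zpowers.2 (hu (Units.mk0 y hy)))
  have hk' : (u : F) ^ k = y := by
    rw [← Units.val_pow_eq_pow_val, hk]; rfl
  have : χ u ^ k = 1 := by rw [← map_pow, hk', h]
  obtain ⟨m, rfl⟩ := hord ▸ orderOf_dvd_of_pow_eq_one this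
  exact ⟨(u : F) ^ m, by rw [← hk', mul_comm 3 m, pow_mul]⟩

lemma exists_prim_three_aux (hcard : Fintype.card F % 3 = 1) : ∃ ζ : F, IsPrimitiveRoot ζ 3 := by
  classical
  have hd : 3 ∣ Nat.card Fˣ := by
    rw [Nat.card_eq_fintype_card, Fintype.card_units]; omega
  obtain ⟨g, hg⟩ := IsCyclic.exists_ofOrder_eq_natCard (α := Fˣ)
  obtain ⟨m, hm⟩ := hd
  have hpos : 0 < Nat.card Fˣ := Nat.card_pos
  have h1 : IsPrimitiveRoot g (Nat.card Fˣ) := hg ▸ IsPrimitiveRoot.orderOf g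
  have h2 := h1.pow hpos (a := m) (b := 3) (by rw [hm, mul_comm])
  exact ⟨((g ^ m : Fˣ) : F), IsPrimitiveRoot.coe_units_iff.2 h2⟩

lemma card_fiber_aux [DecidableEq F] (hcard : Fintype.card F % 3 = 1)
    {χ : MulChar F ℂ} (hχ : orderOf χ = 3) (y : F) :
    ((univ.filter (fun x : F => x ^ 3 = y)).card : ℂ) = 1 + χ y + χ⁻¹ y := by
  rcases eq_or_ne y 0 with rfl | hy
  · have : (univ.filter (fun x : F => x ^ 3 = 0)) = {0} := by
      ext x; simp
    rw [this]; simp [MulChar.map_zero]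
  obtain ⟨ζ, hζ⟩ := exists_prim_three_aux hcard
  have hc : (univ.filter (fun x : F => x ^ 3 = y)).card = if ∃ a, a ^ 3 = y then 3 else 0 := by
    refine Eq.trans ?_ ((hζ.card_nthRoots y).trans (by congr))
    rw [← Multiset.toFinset_card_of_nodup (hζ.nthRoots_nodup hy)]
    congr 1
    ext x
    simp [Polynomial.mem_nthRoots]
  have h3 := chi_cube_aux hχ hy
  have hinv : χ⁻¹ y = χ y ^ 2 := by
    rw [MulChar.inv_apply_eq_inv', inv_eq_iff_eq_inv, eq_comm, inv_eq_iff_eq_inv, eq_comm]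
    have h0 : χ y ≠ 0 := fun h => by simp [h] at h3
    field_simp
    linear_combination -h3
  rw [hc, hinv]
  split_ifs with h
  · obtain ⟨a, rfl⟩ := h
    have ha : a ≠ 0 := by rintro rfl; simp at hy
    rw [map_pow, chi_cube_aux hχ ha]; norm_num
  · have h1 : χ y ≠ 1 := fun h1 => h (exists_cube_of_chi_eq_one hχ hy h1)
    have : (χ y - 1) * (1 + χ y + χ y ^ 2) = 0 := by linear_combination h3
    rcases mul_eq_zero.1 this with h' | h'
    · exact absurd (sub_eq_zero.1 h') h1
    · rw [h']; simp

lemma sum_cube_aux (hcard : Fintype.card F % 3 = 1)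
    {χ : MulChar F ℂ} (hχ : orderOf χ = 3) (f : F → ℂ) :
    ∑ x, f (x ^ 3) = ∑ y, (1 + χ y + χ⁻¹ y) * f y := by
  classical
  rw [← Finset.sum_fiberwise univ (fun x : F => x ^ 3) (fun x => f (x ^ 3))]
  refine Finset.sum_congr rfl fun y _ => ?_
  rw [← card_fiber_aux hcard hχ y, ← nsmul_eq_mul, ← Finset.sum_const]
  refine Finset.sum_congr rfl fun x hx => ?_
  rw [(Finset.mem_filter.1 hx).2]

lemma sum_psi_cube_aux (hcard : Fintype.card F % 3 = 1)
    {χ : MulChar F ℂ} (hχ : orderOf χ = 3) {ψ : AddChar F ℂ} (hψ : ψ ≠ 1) (t : Fˣ) :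
    ∑ x, ψ (t * x ^ 3) = χ⁻¹ t * gaussSum χ ψ + χ t * gaussSum χ⁻¹ ψ := by
  have hp : ψ.IsPrimitive := AddChar.IsPrimitive.of_ne_one hψ
  have h0 : ∑ y, ψ.mulShift (t : F) y = 0 := AddChar.sum_eq_zero_of_ne_one (hp t.ne_zero)
  have h1 := gaussSum_mulShift_eq χ ψ t
  have h2 := gaussSum_mulShift_eq χ⁻¹ ψ t
  rw [inv_inv] at h2
  rw [← h1, ← h2]
  have := sum_cube_aux hcard hχ (ψ.mulShift (t : F))
  simp only [AddChar.mulShift_apply] at this h0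
  rw [this]
  simp only [gaussSum, add_mul, Finset.sum_add_distrib, one_mul, AddChar.mulShift_apply, h0,
    zero_add]

lemma count_aux [DecidableEq F] (hcard : Fintype.card F % 3 = 1)
    {χ : MulChar F ℂ} (hχ : orderOf χ = 3) {ψ : AddChar F ℂ} (hψ : ψ ≠ 1) :
    (Fintype.card F : ℂ) *
      (univ.filter (fun v : F × F × F => v.1 ^ 3 + v.2.1 ^ 3 + v.2.2 ^ 3 = 0)).card =
    (Fintype.card F : ℂ) ^ 3 +
      ((Fintype.card F : ℂ) - 1) * (gaussSum χ ψ ^ 3 + gaussSum χ⁻¹ ψ ^ 3) := by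
  have hp : ψ.IsPrimitive := AddChar.IsPrimitive.of_ne_one hψ
  have hχ1 : χ ≠ 1 := by
    rintro rfl; rw [orderOf_one] at hχ; norm_num at hχ
  have hA : ∑ t : F, (∑ x, ψ (t * x ^ 3)) ^ 3 = (Fintype.card F : ℂ) *
      (univ.filter (fun v : F × F × F => v.1 ^ 3 + v.2.1 ^ 3 + v.2.2 ^ 3 = 0)).card := by
    have e : ∀ t : F, (∑ x, ψ (t * x ^ 3)) ^ 3 =
        ∑ v : F × F × F, ψ (t * (v.1 ^ 3 + v.2.1 ^ 3 + v.2.2 ^ 3)) := by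
      intro t
      simp only [Fintype.sum_prod_type, mul_add, AddChar.map_add_eq_mul, mul_assoc,
        ← Finset.mul_sum, ← Finset.sum_mul]
      ring
    simp only [e]
    rw [Finset.sum_comm]
    have e2 : ∀ b : F, ∑ t : F, ψ (t * b) = if b = 0 then (Fintype.card F : ℂ) else 0 := by
      intro b
      have := AddChar.sum_mulShift b hp
      simpa using this
    simp only [e2]
    rw [← Finset.sum_filter, Finset.sum_const, nsmul_eq_mul, mul_comm]
  rw [← hA]
  have hB : ∑ t : F, (∑ x, ψ (t * x ^ 3)) ^ 3 =
      (Fintype.card F : ℂ) ^ 3 + ∑ t : Fˣ, (∑ x, ψ ((t : F) * x ^ 3)) ^ 3 := by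
    rw [← Finset.add_sum_erase _ _ (Finset.mem_univ (0 : F))]
    congr 1
    · simp
    · refine (Finset.sum_bij (fun (t : Fˣ) _ => (t : F)) ?_ ?_ ?_ ?_).symm
      · intro a _; simp
      · intro a _ b _ h; exact Units.ext h
      · intro b hb; exact ⟨Units.mk0 b (Finset.ne_of_mem_erase hb), Finset.mem_univ _, rfl⟩
      · intro a _; rfl
  rw [hB]
  congr 1
  have hs : ∀ φ : MulChar F ℂ, φ ≠ 1 → ∑ t : Fˣ, φ t = 0 := by
    intro φ hφ
    rw [← MulChar.sum_eq_zero_of_ne_one hφ, ← Finset.add_sum_erase _ _ (Finset.mem_univ (0 : F)),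
      φ.map_zero, zero_add]
    refine (Finset.sum_bij (fun (t : Fˣ) _ => (t : F)) ?_ ?_ ?_ ?_)
    · intro a _; simp
    · intro a _ b _ h; exact Units.ext h
    · intro b hb; exact ⟨Units.mk0 b (Finset.ne_of_mem_erase hb), Finset.mem_univ _, rfl⟩
    · intro a _; rfl
  have hc : ∀ t : Fˣ, (∑ x, ψ ((t : F) * x ^ 3)) ^ 3 =
      (gaussSum χ ψ ^ 3 + gaussSum χ⁻¹ ψ ^ 3) +
      (χ⁻¹ t * (3 * gaussSum χ ψ ^ 2 * gaussSum χ⁻¹ ψ) +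
        χ t * (3 * gaussSum χ ψ * gaussSum χ⁻¹ ψ ^ 2)) := by
    intro t
    rw [sum_psi_cube_aux hcard hχ hψ]
    have h3 := chi_cube_aux hχ t.ne_zero
    have h4 : χ⁻¹ (t : F) * χ t = 1 := by
      rw [← MulChar.mul_apply, inv_mul_cancel, MulChar.one_apply_coe]
    have h5 : χ⁻¹ (t : F) ^ 3 = 1 := by
      have : (χ⁻¹ (t : F) * χ t) ^ 3 = 1 := by rw [h4, one_pow]
      rwa [mul_pow, h3, mul_one] at this
    generalize χ⁻¹ (t : F) = a at *
    generalize χ (t : F) = b at *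
    generalize gaussSum χ ψ = g
    generalize gaussSum χ⁻¹ ψ = g'
    linear_combination g ^ 3 * h5 + g' ^ 3 * h3 + (3 * a * g ^ 2 * g' + 3 * b * g * g' ^ 2) * h4
  simp only [hc]
  rw [Finset.sum_add_distrib, Finset.sum_add_distrib (f := fun t : Fˣ => χ⁻¹ (t : F) * _),
    ← Finset.sum_mul, ← Finset.sum_mul,
    hs χ hχ1, hs χ⁻¹ (inv_ne_one.2 hχ1), Finset.sum_const, Finset.card_univ, Fintype.card_units,
    nsmul_eq_mul, Nat.cast_sub Fintype.card_pos]
  simp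

lemma two_re_aux {z : ℂ} (hz : z ^ 3 = 1) : ∃ n : ℤ, (n : ℝ) = 2 * z.re := by
  by_cases h1 : z = 1
  · exact ⟨2, by simp [h1]⟩
  have hn : ‖z‖ = 1 := Complex.norm_eq_one_of_pow_eq_one hz (by norm_num)
  have h2 : z ^ 2 + z + 1 = 0 := by
    have : (z - 1) * (z ^ 2 + z + 1) = 0 := by linear_combination hz
    exact (mul_eq_zero.1 this).resolve_left (sub_ne_zero.2 h1)
  have hzz : z * (starRingEnd ℂ) z = 1 := by
    rw [Complex.mul_conj, Complex.normSq_eq_norm_sq, hn]; simp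
  have h0 : z ≠ 0 := by rintro rfl; simp at hz
  have : z + (starRingEnd ℂ) z = -1 := by
    apply mul_left_cancel₀ h0
    linear_combination h2 + hzz
  refine ⟨-1, ?_⟩
  have h := congrArg Complex.re this
  simp at h
  push_cast
  linarith

lemma two_re_jacobi_aux {χ : MulChar F ℂ} (hχ : orderOf χ = 3) :
    ∃ n : ℤ, (n : ℝ) = 2 * (jacobiSum χ χ).re := by
  have H : ∀ x : F, ∃ n : ℤ, (n : ℝ) = 2 * (χ x * χ (1 - x)).re := by
    intro x
    rw [← map_mul]
    by_cases h : x * (1 - x) = 0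
    · exact ⟨0, by simp [h, MulChar.map_zero]⟩
    · exact two_re_aux (chi_cube_aux hχ h)
  choose n hn using H
  refine ⟨∑ x, n x, ?_⟩
  rw [jacobiSum, Complex.re_sum, Finset.mul_sum]
  push_cast
  exact Finset.sum_congr rfl fun x _ => hn x

end helpers


/-- Let `F` be a finite field with `|F| ≡ 1 (mod 3)`, let `χ` be a multiplicative
character of `F` of exact order `3`, and let `ψ` be a nontrivial additive character of
`F`. Then `c := 2·Re(g(χ,ψ)³)/|F|` is a rational integer satisfying `|c| ≤ 2·|F|^{1/2}`,
and `#{(x,y,z) ∈ F³ : x³ + y³ + z³ = 0} = |F|² + c·(|F| − 1)`. -/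
theorem count_sum_three_cubes_zero (F : Type*) [Field F] [Fintype F]
    (hcard : Fintype.card F % 3 = 1)
    (χ : MulChar F ℂ) (hχ : orderOf χ = 3)
    (ψ : AddChar F ℂ) (hψ : ψ ≠ 1) :
    ∃ c : ℤ, (c : ℝ) = 2 * (gaussSum χ ψ ^ 3).re / (Fintype.card F : ℝ) ∧
      |(c : ℝ)| ≤ 2 * Real.sqrt (Fintype.card F) ∧
      (Nat.card {v : F × F × F // v.1 ^ 3 + v.2.1 ^ 3 + v.2.2 ^ 3 = 0} : ℝ) =
        (Fintype.card F : ℝ) ^ 2 + (c : ℝ) * ((Fintype.card F : ℝ) - 1) := by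
  classical
  have hp : ψ.IsPrimitive := AddChar.IsPrimitive.of_ne_one hψ
  have hχ1 : χ ≠ 1 := by
    rintro rfl; rw [orderOf_one] at hχ; norm_num at hχ
  have hq : (Fintype.card F : ℂ) ≠ 0 := Nat.cast_ne_zero.2 Fintype.card_ne_zero
  have hqR : (Fintype.card F : ℝ) ≠ 0 := Nat.cast_ne_zero.2 Fintype.card_ne_zero
  have hqpos : (0 : ℝ) < Fintype.card F := Nat.cast_pos.2 Fintype.card_pos
  have hm1 := chi_neg_one_aux hχ
  have hconj : gaussSum χ⁻¹ ψ = star (gaussSum χ ψ) := by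
    rw [star_gaussSum_eq, ← mul_gaussSum_inv_eq_gaussSum χ⁻¹ ψ, MulChar.inv_apply_eq_inv', hm1]
    simp
  have hnorm : ‖gaussSum χ ψ‖ ^ 2 = (Fintype.card F : ℝ) := by
    have h := gaussSum_mul_gaussSum_eq_card hχ1 hp
    rw [← star_gaussSum_eq, ← starRingEnd_apply, Complex.mul_conj, Complex.normSq_eq_norm_sq] at h
    exact_mod_cast h
  have hg3 : gaussSum χ ψ ^ 3 = (Fintype.card F : ℂ) * jacobiSum χ χ := by
    have h := gaussSum_pow_eq_prod_jacobiSum (χ := χ) (ψ := ψ) (by omega) hp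
    rw [hχ, hm1] at h
    simpa using h
  obtain ⟨c, hc⟩ := two_re_jacobi_aux hχ
  have hre : (gaussSum χ ψ ^ 3).re = (Fintype.card F : ℝ) * (jacobiSum χ χ).re := by
    rw [hg3, ← Complex.ofReal_natCast, Complex.re_ofReal_mul]
  have hc1 : (c : ℝ) = 2 * (gaussSum χ ψ ^ 3).re / (Fintype.card F : ℝ) := by
    rw [hc, hre]; field_simp
  refine ⟨c, hc1, ?_, ?_⟩
  · have hs : ‖gaussSum χ ψ‖ = Real.sqrt (Fintype.card F) := by
      rw [← hnorm, Real.sqrt_sq (norm_nonneg _)]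
    have h := Complex.abs_re_le_norm (gaussSum χ ψ ^ 3)
    rw [norm_pow, pow_succ ‖gaussSum χ ψ‖, hnorm, hs] at h
    rw [hc1, abs_div, abs_mul, abs_two, abs_of_pos hqpos, div_le_iff₀ hqpos]
    linarith
  · have h := count_aux hcard hχ hψ
    rw [hconj, ← star_pow] at h
    have h' := congrArg Complex.re h
    have e : gaussSum χ ψ ^ 3 + star (gaussSum χ ψ ^ 3) = ((2 * (gaussSum χ ψ ^ 3).re : ℝ) : ℂ) := by
      rw [← starRingEnd_apply, Complex.add_conj]
    rw [e] at h
    have h2 : (Fintype.card F : ℝ) *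
        (univ.filter (fun v : F × F × F => v.1 ^ 3 + v.2.1 ^ 3 + v.2.2 ^ 3 = 0)).card =
        (Fintype.card F : ℝ) ^ 3 +
        ((Fintype.card F : ℝ) - 1) * (2 * (gaussSum χ ψ ^ 3).re) := by
      exact_mod_cast h
    rw [Nat.card_eq_fintype_card, Fintype.card_subtype]
    apply mul_left_cancel₀ hqR
    rw [h2, hc1]
    field_simp
end
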